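/- arXiv:2310.18980 — 4 statements merged into one kernel-verified Lean document; each statement's English description precedes it below -/
import Mathlib

section
/- Let r ≥ 3 and k ≥ 1 be integers, let C ≥ 4er^2·binom(k+r-2, r-1)·((2k+2r-3)e)^{1/binom(k+r-2, r-1)} be a constant, and let p = C·n^{-1/binom(k+r-2, r-1)}. Then there exists a constant δ > 0 depending only on r and k such that for all sufficiently large n, the probability that the random r-graph H^{(r)}(n,p) contains a spanning copy of the kth power of a tight Hamilton cycle is at least δ. -/
open scoped Classical
open Finset

noncomputable section

/-- The window of `k+r-1` cyclically consecutive vertices starting at position `i`,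
under the cyclic ordering `σ`. -/
def cycWindow (k r n : ℕ) (σ : ZMod n → Fin n) (i : ZMod n) : Finset (Fin n) :=
  (Finset.range (k + r - 1)).image fun j => σ (i + (j : ZMod n))

/-- The edge set of the `k`th power of a tight Hamilton cycle on `[n]` associated with
the cyclic ordering `σ`: all `r`-sets contained in some window of `k+r-1`
cyclically consecutive vertices. -/
def hamPowEdges (r k n : ℕ) (σ : ZMod n → Fin n) : Finset (Finset (Fin n)) :=
  Finset.univ.filter fun e => e.card = r ∧ ∃ i : ZMod n, e ⊆ cycWindow k r n σ i

/-- All `r`-element subsets of `Fin n`. -/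
def rSets (n r : ℕ) : Finset (Finset (Fin n)) := Finset.univ.filter fun e => e.card = r

/-- The probability weight of a given `r`-graph `H` in the binomial random
`r`-graph `H^{(r)}(n,p)`. -/
def prW (n r : ℕ) (p : ℝ) (H : Finset (Finset (Fin n))) : ℝ :=
  p ^ H.card * (1 - p) ^ ((rSets n r).card - H.card)

/-- The probability that `H^{(r)}(n,p)` satisfies the property `A`. -/
def probOf (n r : ℕ) (p : ℝ) (A : Finset (Finset (Fin n)) → Prop) : ℝ :=
  ∑ H ∈ (rSets n r).powerset, if A H then prW n r p H else 0

/-- The expectation of `f` with respect to the random `r`-graph `H^{(r)}(n,p)`. -/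
def expct (n r : ℕ) (p : ℝ) (f : Finset (Finset (Fin n)) → ℝ) : ℝ :=
  ∑ H ∈ (rSets n r).powerset, prW n r p H * f H

/-- `H` contains (a spanning copy of) the `k`th power of a tight Hamilton cycle. -/
def containsHamPow (r k n : ℕ) (H : Finset (Finset (Fin n))) : Prop :=
  ∃ σ : ZMod n → Fin n, Function.Bijective σ ∧ hamPowEdges r k n σ ⊆ H

/-- Degree of a vertex in a hypergraph given by its edge set. -/
def degOf (n : ℕ) (H : Finset (Finset (Fin n))) (v : Fin n) : ℕ :=
  (H.filter fun e => v ∈ e).card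

/-- The auxiliary graph on the edges of a hypergraph `P`, two edges being adjacent
iff they are distinct and share a vertex. -/
def edgeGraph {n : ℕ} (P : Finset (Finset (Fin n))) : SimpleGraph {e // e ∈ P} :=
  SimpleGraph.fromRel fun e f => (e.1 ∩ f.1).Nonempty

/-- The number of connected components of the hypergraph with edge set `P`. -/
def numComp {n : ℕ} (P : Finset (Finset (Fin n))) : ℕ :=
  Nat.card (edgeGraph P).ConnectedComponent

/-- The set of vertices covered by the edges of `P`. -/
def vertsOf {n : ℕ} (P : Finset (Finset (Fin n))) : Finset (Fin n) := P.biUnion id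

/-- `σ` is the canonical representative of a cyclic ordering of `[n]`
(a permutation considered up to rotation and reflection). -/
def IsCycRep (n : ℕ) (σ : ZMod n → Fin n) : Prop :=
  Function.Bijective σ ∧ (σ 0).val = 0 ∧ (σ 1).val < (σ (-1)).val

/-- `|Q_n|`, the number of cyclic orderings of `[n]`. -/
def QCard (n : ℕ) : ℕ := Nat.card {σ : ZMod n → Fin n // IsCycRep n σ}

/-- `N_σ(b)`: the number of cyclic orderings `τ ∈ Q_n` such that `H_σ` and `H_τ`
share exactly `b` edges. -/
def NQ (r k n : ℕ) (σ : ZMod n → Fin n) (b : ℕ) : ℕ :=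
  Nat.card {τ : ZMod n → Fin n //
    IsCycRep n τ ∧ (hamPowEdges r k n σ ∩ hamPowEdges r k n τ).card = b}

/-- `N_σ(b,s)`: the number of cyclic orderings `τ ∈ Q_n` such that `H_σ ∩ H_τ`
has exactly `b` edges and exactly `s` connected components. -/
def NQs (r k n : ℕ) (σ : ZMod n → Fin n) (b s : ℕ) : ℕ :=
  Nat.card {τ : ZMod n → Fin n //
    IsCycRep n τ ∧ (hamPowEdges r k n σ ∩ hamPowEdges r k n τ).card = b ∧
      numComp (hamPowEdges r k n σ ∩ hamPowEdges r k n τ) = s}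

/-- The random variable `X`: the number of cyclic orderings `σ ∈ Q_n` with `H_σ ⊆ H`. -/
def XH (r k n : ℕ) (H : Finset (Finset (Fin n))) : ℝ :=
  Nat.card {σ : ZMod n → Fin n // IsCycRep n σ ∧ hamPowEdges r k n σ ⊆ H}

/-- The auxiliary graph on a finite set `P` of edges of a simple graph, two edges
being adjacent iff they are distinct and share a vertex. -/
def edgeGraphS {V : Type*} (P : Finset (Sym2 V)) : SimpleGraph {e // e ∈ P} :=
  SimpleGraph.fromRel fun e f => ∃ x, x ∈ e.1 ∧ x ∈ f.1

/-- Number of further positions, counted from `m`, that lie within distance `w` of an element of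
`S` below `m`; before any element is met, position `0` counts as the successor of an element. -/
def countdown (w : ℕ) : ℕ → Finset ℕ → ℕ
  | 0, _ => w
  | m + 1, S => if m ∈ S then w else countdown w m S - 1

/-- Product over the elements of `S` below `m` of a factor `ρ` for the elements following
another one within distance `w`, and `x` for the other ones. -/
def chainWeight (w : ℕ) (x ρ : ℝ) : ℕ → Finset ℕ → ℝ
  | 0, _ => 1
  | m + 1, S => chainWeight w x ρ m S *
      (if m ∈ S then (if 0 < countdown w m S then ρ else x) else 1)

lemma countdown_congr (w m : ℕ) {S T : Finset ℕ} (h : ∀ i < m, i ∈ S ↔ i ∈ T) :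
    countdown w m S = countdown w m T := by
  induction m with
  | zero => rfl
  | succ m ih =>
    simp only [countdown, h m (Nat.lt_succ_self m), ih fun i hi => h i (by omega)]

lemma chainWeight_congr (w : ℕ) (x ρ : ℝ) (m : ℕ) {S T : Finset ℕ}
    (h : ∀ i < m, i ∈ S ↔ i ∈ T) : chainWeight w x ρ m S = chainWeight w x ρ m T := by
  induction m with
  | zero => rfl
  | succ m ih =>
    have h' : ∀ i < m, i ∈ S ↔ i ∈ T := fun i hi => h i (by omega)
    simp only [chainWeight, h m (Nat.lt_succ_self m), ih h', countdown_congr w m h']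

lemma chainWeight_nonneg (w : ℕ) {x ρ : ℝ} (hx : 0 ≤ x) (hρ : 0 ≤ ρ) (m : ℕ) (S : Finset ℕ) :
    0 ≤ chainWeight w x ρ m S := by
  induction m with
  | zero => simp [chainWeight]
  | succ m ih =>
    refine mul_nonneg ih ?_
    split_ifs <;> first | assumption | exact zero_le_one

lemma sub_le_countdown (w m : ℕ) (S : Finset ℕ) : w - m ≤ countdown w m S := by
  induction m with
  | zero => simp [countdown]
  | succ m ih => simp only [countdown]; split_ifs <;> omega

lemma sub_le_countdown_of_mem (w m : ℕ) {S : Finset ℕ} {i : ℕ} (hi : i ∈ S) (him : i < m) :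
    w - (m - 1 - i) ≤ countdown w m S := by
  induction m with
  | zero => omega
  | succ m ih =>
    simp only [countdown]
    split_ifs with h
    · omega
    · rcases Nat.lt_succ_iff_lt_or_eq.1 him with h1 | rfl
      · have := ih h1; omega
      · exact absurd hi h

lemma sum_chainWeight_mul_le (w : ℕ) {x ρ : ℝ} (hx : 0 ≤ x) (hρ : 0 ≤ ρ)
    (hw : ρ * w ≤ 1 / 2) (m : ℕ) :
    ∑ S ∈ (range m).powerset, chainWeight w x ρ m S * (1 + 2 * ρ * countdown w m S)
      ≤ 2 * (1 + 2 * x) ^ m := by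
  induction m with
  | zero => simp [chainWeight, countdown]; linarith
  | succ m ih =>
    rw [range_add_one, sum_powerset_insert notMem_range_self, ← sum_add_distrib]
    calc _ ≤ ∑ S ∈ (range m).powerset,
          chainWeight w x ρ m S * (1 + 2 * ρ * countdown w m S) * (1 + 2 * x) := by
          refine sum_le_sum fun S hS => ?_
          have hm : m ∉ S := fun h => by simpa using mem_powerset.1 hS h
          have hc : ∀ i < m, i ∈ insert m S ↔ i ∈ S := fun i hi => by
            simp [hi.ne]
          simp only [chainWeight, countdown, hm, mem_insert_self, if_true, if_false,
            chainWeight_congr w x ρ m hc, countdown_congr w m hc]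
          have h0 := chainWeight_nonneg w hx hρ m S
          suffices key : 1 + 2 * ρ * ((countdown w m S - 1 : ℕ) : ℝ) +
              (if 0 < countdown w m S then ρ else x) * (1 + 2 * ρ * w) ≤
              (1 + 2 * ρ * countdown w m S) * (1 + 2 * x) by
            linarith [mul_le_mul_of_nonneg_left key h0]
          split_ifs with h
          · have : ((countdown w m S - 1 : ℕ) : ℝ) = countdown w m S - 1 := by
              rw [Nat.cast_sub h]; simp
            rw [this]
            have h1 : 0 ≤ 2 * ρ * (countdown w m S : ℝ) := by positivity
            nlinarith [mul_nonneg h1 hx]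
          · have : countdown w m S = 0 := by omega
            rw [this]
            simp only [Nat.zero_sub, Nat.cast_zero]
            nlinarith
      _ ≤ _ := by
          rw [← sum_mul, pow_succ, ← mul_assoc]
          exact mul_le_mul_of_nonneg_right ih (by positivity)

lemma sum_chainWeight_le (w : ℕ) {x ρ : ℝ} (hx : 0 ≤ x) (hρ : 0 ≤ ρ)
    (hw : ρ * w ≤ 1 / 2) (m : ℕ) :
    ∑ S ∈ (range m).powerset, chainWeight w x ρ m S ≤ 2 * (1 + 2 * x) ^ m := by
  refine (sum_le_sum fun S _ => ?_).trans (sum_chainWeight_mul_le w hx hρ hw m)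
  exact le_mul_of_one_le_right (chainWeight_nonneg w hx hρ m S) (by
    have : 0 ≤ 2 * ρ * (countdown w m S : ℝ) := by positivity
    linarith)

lemma pow_mul_pow_le_chainWeight (w : ℕ) {x y : ℝ} (hx : 0 ≤ x) (hy : 1 ≤ y) (n : ℕ)
    {S T : Finset ℕ} (hS : S ⊆ range n) (hTS : T ⊆ S)
    (hT : ∀ i ∈ T, i < w ∨ ∃ j ∈ S, j < i ∧ i ≤ j + w) :
    x ^ #S * y ^ #T ≤ chainWeight w x (x * y) n S := by
  have key : ∀ m, (∏ i ∈ range m, if i ∈ S then x else 1) *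
      (∏ i ∈ range m, if i ∈ T then y else 1) ≤ chainWeight w x (x * y) m S := by
    intro m
    induction m with
    | zero => simp [chainWeight]
    | succ m ih =>
      rw [prod_range_succ, prod_range_succ, mul_mul_mul_comm]
      simp only [chainWeight]
      have hy0 : 0 ≤ y := by linarith
      refine mul_le_mul ih ?_ ?_ (chainWeight_nonneg w hx (by positivity) m S)
      · by_cases hmT : m ∈ T
        · have hc : 0 < countdown w m S := by
            rcases hT m hmT with h | ⟨j, hj, h1, h2⟩
            · have := sub_le_countdown w m S; omega
            · have := sub_le_countdown_of_mem w m hj h1; omega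
          simp [hmT, hTS hmT, hc]
        · simp only [hmT, if_false, mul_one]
          split_ifs
          · exact le_mul_of_one_le_right hx hy
          · exact le_rfl
          · exact le_rfl
      · split_ifs <;> positivity
  refine le_trans (le_of_eq ?_) (key n)
  have aux : ∀ U ⊆ range n, ∀ z : ℝ, (∏ i ∈ range n, if i ∈ U then z else 1) = z ^ #U := by
    intro U hU z
    rw [prod_ite_mem, inter_eq_right.2 hU, prod_const]
  rw [aux S hS, aux T (hTS.trans hS)]

/-- Members of `S` preceded cyclically within distance `w` by another member of `S`. -/
def followers (n w : ℕ) (S : Finset (ZMod n)) : Finset (ZMod n) :=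
  S.filter fun i => ∃ j ∈ Icc 1 w, i - (j : ZMod n) ∈ S

lemma sum_pow_followers_le (n w : ℕ) [NeZero n] {x y : ℝ} (hx : 0 ≤ x) (hy : 1 ≤ y)
    (hw : x * y * w ≤ 1 / 2) :
    ∑ S : Finset (ZMod n), x ^ #S * y ^ #(followers n w S) ≤ 2 * (1 + 2 * x) ^ n := by
  have hinj := ZMod.val_injective n
  have hsub : ∀ S : Finset (ZMod n), S.image ZMod.val ⊆ range n := fun S i hi => by
    obtain ⟨a, -, rfl⟩ := mem_image.1 hi
    exact mem_range.2 (ZMod.val_lt a)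
  have hρ : 0 ≤ x * y := mul_nonneg hx (by linarith)
  calc _ ≤ ∑ S : Finset (ZMod n), chainWeight w x (x * y) n (S.image ZMod.val) := by
        refine sum_le_sum fun S _ => ?_
        rw [← card_image_of_injective S hinj,
          ← card_image_of_injective (followers n w S) hinj]
        refine pow_mul_pow_le_chainWeight w hx hy n (hsub S)
          (image_subset_image (filter_subset _ _)) fun i hi => ?_
        obtain ⟨a, ha, rfl⟩ := mem_image.1 hi
        obtain ⟨-, j, hj, haj⟩ := mem_filter.1 ha
        rw [mem_Icc] at hj
        by_cases h : a.val < w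
        · exact Or.inl h
        refine Or.inr ⟨_, mem_image_of_mem _ haj, ?_⟩
        have hlt := ZMod.val_lt a
        have hjv : (j : ZMod n).val = j := ZMod.val_natCast_of_lt (by omega)
        rw [ZMod.val_sub (by omega), hjv]
        omega
    _ = ∑ T ∈ univ.image fun S : Finset (ZMod n) => S.image ZMod.val,
          chainWeight w x (x * y) n T := by
        rw [sum_image]
        exact fun S _ T _ h => image_injective hinj h
    _ ≤ ∑ T ∈ (range n).powerset, chainWeight w x (x * y) n T := by
        refine sum_le_sum_of_subset_of_nonneg ?_ fun T _ _ => chainWeight_nonneg w hx hρ n T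
        intro T hT
        obtain ⟨S, -, rfl⟩ := mem_image.1 hT
        exact mem_powerset.2 (hsub S)
    _ ≤ _ := sum_chainWeight_le w hx hρ hw n

/-- `x` and `y` are at cyclic distance at most `w`. -/
def CycNear {n : ℕ} (w : ℕ) (x y : ZMod n) : Prop :=
  ∃ c ∈ Icc (-(w : ℤ)) w, x = y + (c : ZMod n)

/-- Injective sequences in `ZMod n` all of whose entries indexed by `T` are close to one of the
`w` preceding entries. -/
def linkedSeqs (n w : ℕ) [NeZero n] (T : Finset ℕ) (m : ℕ) : Finset (Fin m → ZMod n) :=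
  univ.filter fun f => Function.Injective f ∧
    ∀ j : Fin m, j.val ∈ T → ∃ i : Fin m, i < j ∧ j.val ≤ i.val + w ∧ CycNear w (f j) (f i)

lemma card_linkedSeqs_le (n w : ℕ) [NeZero n] (T : Finset ℕ) (m : ℕ) :
    #(linkedSeqs n w T m) ≤ ∏ j ∈ range m, if j ∈ T then w * (2 * w + 1) else n - j := by
  induction m with
  | zero => exact (card_le_univ _).trans (by simp)
  | succ m ih =>
    rw [prod_range_succ, mul_comm]
    refine (card_le_mul_card_image_of_maps_to (f := fun f i => f (Fin.castSucc i))
      (t := linkedSeqs n w T m) ?_ (if m ∈ T then w * (2 * w + 1) else n - m) ?_).trans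
      (Nat.mul_le_mul_left _ ih)
    · intro f hf
      obtain ⟨-, hinj, hf⟩ := mem_filter.1 hf
      refine mem_filter.2 ⟨mem_univ _, hinj.comp (Fin.castSucc_injective m), fun j hj => ?_⟩
      obtain ⟨i, hij, h1, h2⟩ := hf j.castSucc hj
      have hi : i.val < m := lt_trans (Fin.lt_def.1 hij) j.isLt
      exact ⟨⟨i, hi⟩, hij, h1, h2⟩
    · intro g hg
      obtain ⟨-, hgi, -⟩ := mem_filter.1 hg
      set fib := {f ∈ linkedSeqs n w T (m + 1) | (fun i => f (Fin.castSucc i)) = g}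
      have hinj : Set.InjOn (fun f : Fin (m + 1) → ZMod n => f (Fin.last m)) fib := by
        intro f hf f' hf' h
        have h1 := (mem_filter.1 hf).2
        have h2 := (mem_filter.1 hf').2
        funext i
        refine Fin.lastCases h (fun i => ?_) i
        exact congrFun (h1.trans h2.symm) i
      rw [← card_image_of_injOn hinj]
      split_ifs with hm
      · have hsub : fib.image (fun f : Fin (m + 1) → ZMod n => f (Fin.last m)) ⊆
            (univ.filter fun i : Fin m => m ≤ i.val + w).biUnion
              fun i => (Icc (-(w : ℤ)) w).image fun c : ℤ => g i + (c : ZMod n) := by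
          intro z hz
          obtain ⟨f, hf, rfl⟩ := mem_image.1 hz
          obtain ⟨hfs, rfl⟩ := mem_filter.1 hf
          obtain ⟨i, hij, h1, c, hc, h2⟩ := (mem_filter.1 hfs).2.2 (Fin.last m) hm
          have hi : i.val < m := Fin.lt_def.1 hij
          exact mem_biUnion.2 ⟨⟨i, hi⟩, mem_filter.2 ⟨mem_univ _, h1⟩,
            mem_image.2 ⟨c, hc, h2.symm⟩⟩
        refine (card_le_card hsub).trans (card_biUnion_le_card_mul _ _ (2 * w + 1) ?_ |>.trans
          (Nat.mul_le_mul_right _ ?_))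
        · intro i _
          refine card_image_le.trans ?_
          rw [Int.card_Icc]; omega
        · have : (univ.filter fun i : Fin m => m ≤ i.val + w).image Fin.val ⊆ Ico (m - w) m := by
            intro j hj
            obtain ⟨i, hi, rfl⟩ := mem_image.1 hj
            have := (mem_filter.1 hi).2
            have := i.isLt
            rw [mem_Ico]; omega
          rw [← card_image_of_injective _ Fin.val_injective]
          refine (card_le_card this).trans ?_
          rw [Nat.card_Ico]; omega
      · have hsub : fib.image (fun f : Fin (m + 1) → ZMod n => f (Fin.last m)) ⊆
            (univ.image g)ᶜ := by
          intro z hz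
          obtain ⟨f, hf, rfl⟩ := mem_image.1 hz
          obtain ⟨hfs, rfl⟩ := mem_filter.1 hf
          simp only [mem_compl, mem_image, mem_univ, true_and, not_exists]
          intro i hi
          exact absurd ((mem_filter.1 hfs).2.1 hi) (Fin.castSucc_lt_last i).ne
        refine (card_le_card hsub).trans ?_
        rw [card_compl, card_image_of_injective _ hgi]
        simp [ZMod.card]

/-- Positions at which `π` is close to its value at one of the `w` cyclically preceding
positions. -/
def linkedPositions {n : ℕ} [NeZero n] (w : ℕ) (π : Equiv.Perm (ZMod n)) : Finset (ZMod n) :=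
  univ.filter fun i => ∃ j ∈ Icc 1 w, CycNear w (π i) (π (i - (j : ZMod n)))

lemma card_perm_linked_le_prod (n w : ℕ) [NeZero n] (S : Finset (ZMod n)) (g : ZMod n) :
    #{π : Equiv.Perm (ZMod n) | S ⊆ linkedPositions w π} ≤ ∏ j ∈ range n,
      if j ∈ (S.image fun i => (i - g).val).filter (w ≤ ·) then w * (2 * w + 1) else n - j := by
  refine le_trans ?_ (card_linkedSeqs_le n w _ n)
  refine card_le_card_of_injOn (fun π j => π (g + (j.val : ZMod n))) ?_ ?_
  · intro π hπ
    replace hπ : S ⊆ linkedPositions w π := by simpa using hπ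
    refine mem_filter.2 ⟨mem_univ _, ?_, ?_⟩
    · intro a b hab
      have h := congrArg ZMod.val (add_left_cancel (π.injective hab))
      rw [ZMod.val_natCast_of_lt a.isLt, ZMod.val_natCast_of_lt b.isLt] at h
      exact Fin.ext h
    · intro j hj
      obtain ⟨hj, hwj⟩ := mem_filter.1 hj
      obtain ⟨i, hi, hij⟩ := mem_image.1 hj
      obtain ⟨-, d, hd, hnear⟩ := mem_filter.1 (hπ hi)
      rw [mem_Icc] at hd
      have hjlt := j.isLt
      have hgj : g + (j.val : ZMod n) = i := by
        rw [← hij, ZMod.natCast_zmod_val, add_sub_cancel]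
      refine ⟨⟨j.val - d, by omega⟩, ?_, ?_, ?_⟩
      · rw [Fin.lt_def]; simp only; omega
      · simp only; omega
      · simp only
        rw [Nat.cast_sub (by omega), ← add_sub_assoc, hgj]
        exact hnear
  · intro π _ π' _ h
    ext x
    have h1 := congrFun h ⟨(x - g).val, ZMod.val_lt _⟩
    simp only [ZMod.natCast_zmod_val, add_sub_cancel] at h1
    rw [h1]

lemma sum_zmod_val (n : ℕ) [NeZero n] (h : ℕ → ℝ) :
    ∑ a : ZMod n, h a.val = ∑ j ∈ range n, h j := by
  refine sum_nbij' ZMod.val (fun j => (j : ZMod n)) ?_ ?_ ?_ ?_ ?_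
  · intro a _; exact mem_range.2 (ZMod.val_lt a)
  · intro j _; exact mem_univ _
  · intro a _; exact ZMod.natCast_zmod_val a
  · intro j hj; exact ZMod.val_natCast_of_lt (mem_range.1 hj)
  · intro a _; rfl

lemma prod_range_sub_eq_factorial (n : ℕ) : ∏ j ∈ range n, (n - j) = n.factorial := by
  rw [← prod_range_add_one_eq_factorial, ← prod_range_reflect]
  refine prod_congr rfl fun j hj => ?_
  have := mem_range.1 hj
  omega

/-- Cost, relative to `1 / n`, of an element at position `j` in the linear exposure order. -/
def exposureCost (n w j : ℕ) : ℝ :=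
  if j < w then (n : ℝ) else (n : ℝ) / ((n - j : ℕ) : ℝ)

lemma exposureCost_pos {n w j : ℕ} (hj : j < n) : 0 < exposureCost n w j := by
  have h1 : 0 < n := by omega
  have h2 : 0 < n - j := by omega
  unfold exposureCost
  split_ifs <;> positivity

lemma sum_log_exposureCost_le (n w : ℕ) [NeZero n] (hn : w * Real.log n ≤ n) :
    ∑ j ∈ range n, Real.log (exposureCost n w j) ≤ 2 * n := by
  have hn0 : 0 < n := NeZero.pos n
  have hlog : 0 ≤ Real.log n := Real.log_natCast_nonneg n
  calc _ ≤ ∑ j ∈ range n, ((if j < w then Real.log n else 0) +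
        Real.log ((n : ℝ) / ((n - j : ℕ) : ℝ))) := by
        refine sum_le_sum fun j hj => ?_
        have hj := mem_range.1 hj
        have h2 : (0 : ℝ) < ((n - j : ℕ) : ℝ) := by
          have : 0 < n - j := by omega
          positivity
        unfold exposureCost
        split_ifs
        · refine le_add_of_nonneg_right (Real.log_nonneg ?_)
          rw [one_le_div h2]
          exact_mod_cast Nat.sub_le n j
        · rw [zero_add]
    _ = (∑ j ∈ range n, if j < w then Real.log n else 0) +
        Real.log ((n : ℝ) ^ n / n.factorial) := by
        rw [sum_add_distrib, ← Real.log_prod]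
        · congr 2
          rw [prod_div_distrib, prod_const, card_range, ← prod_range_sub_eq_factorial n]
          push_cast
          rfl
        · intro j hj
          have hj := mem_range.1 hj
          have : 0 < n - j := by omega
          positivity
    _ ≤ w * Real.log n + n := by
        refine add_le_add ?_ ?_
        · rw [← sum_filter, sum_const, nsmul_eq_mul]
          refine mul_le_mul_of_nonneg_right ?_ hlog
          have : (range n).filter (· < w) ⊆ range w := fun j hj =>
            mem_range.2 (mem_filter.1 hj).2
          exact_mod_cast (card_le_card this).trans (card_range w).le
        · rw [Real.log_le_iff_le_exp (by positivity)]
          exact Real.pow_div_factorial_le_exp _ (by positivity) n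
    _ ≤ _ := by linarith

lemma exists_shift_sum_le (n w : ℕ) [NeZero n] (hn : w * Real.log n ≤ n) (S : Finset (ZMod n)) :
    ∃ g : ZMod n, ∑ i ∈ S, Real.log (exposureCost n w (i - g).val) ≤ 2 * #S := by
  obtain ⟨g, -, hg⟩ := exists_le_of_sum_le (s := (univ : Finset (ZMod n))) univ_nonempty
    (f := fun g => ∑ i ∈ S, Real.log (exposureCost n w (i - g).val))
    (g := fun _ => (2 * #S : ℝ)) (by
      rw [sum_comm]
      have : ∀ i ∈ S, ∑ g : ZMod n, Real.log (exposureCost n w (i - g).val) ≤ 2 * n := by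
        intro i _
        refine le_of_eq_of_le ((Equiv.subLeft i).sum_comp
          fun a : ZMod n => Real.log (exposureCost n w a.val)) ?_
        rw [sum_zmod_val n fun j => Real.log (exposureCost n w j)]
        exact sum_log_exposureCost_le n w hn
      refine (sum_le_sum this).trans (le_of_eq ?_)
      simp [ZMod.card]; ring)
  exact ⟨g, hg⟩

lemma card_perm_linked_le (n w : ℕ) [NeZero n] (hw : 1 ≤ w) (hn : w * Real.log n ≤ n)
    (S : Finset (ZMod n)) :
    (#{π : Equiv.Perm (ZMod n) | S ⊆ linkedPositions w π} : ℝ) ≤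
      n.factorial * (Real.exp 2 * (w * (2 * w + 1)) / n) ^ #S := by
  obtain ⟨g, hg⟩ := exists_shift_sum_le n w hn S
  have hn0 : (0 : ℝ) < n := by exact_mod_cast NeZero.pos n
  set A : ℝ := w * (2 * w + 1) with hA
  have hA1 : 1 ≤ A := by
    have : (1 : ℝ) ≤ w := by exact_mod_cast hw
    nlinarith
  set U := S.image fun i => (i - g).val
  have hinj : Function.Injective fun i : ZMod n => (i - g).val :=
    (ZMod.val_injective n).comp (sub_left_injective (b := g))
  have hU : U ⊆ range n := fun j hj => by
    obtain ⟨a, -, rfl⟩ := mem_image.1 hj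
    exact mem_range.2 (ZMod.val_lt _)
  calc (#{π : Equiv.Perm (ZMod n) | S ⊆ linkedPositions w π} : ℝ)
      ≤ ∏ j ∈ range n, if j ∈ U.filter (w ≤ ·) then A else ((n - j : ℕ) : ℝ) := by
        have h := card_perm_linked_le_prod n w S g
        have h' : (#{π : Equiv.Perm (ZMod n) | S ⊆ linkedPositions w π} : ℝ) ≤
          ((∏ j ∈ range n, if j ∈ U.filter (w ≤ ·) then w * (2 * w + 1) else n - j : ℕ) : ℝ) :=
          by exact_mod_cast h
        refine h'.trans (le_of_eq ?_)
        push_cast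
        rfl
    _ ≤ ∏ j ∈ range n, ((n - j : ℕ) : ℝ) *
          (if j ∈ U then A / n * exposureCost n w j else 1) := by
        refine prod_le_prod (fun j _ => by split_ifs <;> positivity) fun j hj => ?_
        have hj := mem_range.1 hj
        have h2 : (1 : ℝ) ≤ ((n - j : ℕ) : ℝ) := by
          have : 1 ≤ n - j := by omega
          exact_mod_cast this
        by_cases hjU : j ∈ U
        · by_cases hjw : w ≤ j
          · simp only [mem_filter, hjU, hjw, and_self, if_true, exposureCost, not_lt.2 hjw,
              if_false]
            exact le_of_eq (by field_simp)
          · simp only [mem_filter, hjU, hjw, and_false, if_true, exposureCost, not_le.1 hjw,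
              if_false]
            rw [div_mul_cancel₀ _ hn0.ne']
            exact le_mul_of_one_le_right (by linarith) hA1
        · simp [hjU]
    _ = n.factorial * ((A / n) ^ #S * ∏ i ∈ S, exposureCost n w (i - g).val) := by
        rw [prod_mul_distrib, ← prod_range_sub_eq_factorial n, prod_ite_mem,
          inter_eq_right.2 hU, prod_mul_distrib, prod_const, card_image_of_injective S hinj,
          prod_image fun a _ b _ h => hinj h]
        push_cast
        rfl
    _ ≤ n.factorial * ((A / n) ^ #S * Real.exp (2 * #S)) := by
        have hpos : 0 < ∏ i ∈ S, exposureCost n w (i - g).val :=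
          prod_pos fun i _ => exposureCost_pos (ZMod.val_lt _)
        have : ∏ i ∈ S, exposureCost n w (i - g).val ≤ Real.exp (2 * #S) := by
          rw [← Real.log_le_iff_le_exp hpos, Real.log_prod]
          · exact hg
          · exact fun i _ => (exposureCost_pos (ZMod.val_lt _)).ne'
        gcongr
    _ = _ := by
        rw [mul_comm (2 : ℝ), Real.exp_nat_mul, ← mul_pow]
        congr 2
        ring


lemma sum_pow_followers_linkedPositions_le (n w : ℕ) [NeZero n] (hw : 1 ≤ w)
    (hn : w * Real.log n ≤ n) {K y : ℝ} (hK : K = Real.exp 2 * (w * (2 * w + 1))) (hy : 1 ≤ y)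
    (hKy : K / n * y * w ≤ 1 / 2) :
    ∑ π : Equiv.Perm (ZMod n), y ^ #(followers n w (linkedPositions w π)) ≤
      n.factorial * (2 * Real.exp (2 * K)) := by
  have hn0 : (0 : ℝ) < n := by exact_mod_cast NeZero.pos n
  have hK0 : 0 ≤ K := by rw [hK]; positivity
  have hx : 0 ≤ K / n := by positivity
  calc _ = ∑ S : Finset (ZMod n), ∑ π : Equiv.Perm (ZMod n) with linkedPositions w π = S,
          y ^ #(followers n w (linkedPositions w π)) :=
        (sum_fiberwise univ (linkedPositions w) _).symm
    _ ≤ ∑ S : Finset (ZMod n), n.factorial * ((K / n) ^ #S * y ^ #(followers n w S)) := by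
        refine sum_le_sum fun S _ => ?_
        have h1 : ∀ π ∈ ({π | linkedPositions w π = S} : Finset (Equiv.Perm (ZMod n))),
            y ^ #(followers n w (linkedPositions w π)) = y ^ #(followers n w S) := by
          intro π hπ
          rw [(mem_filter.1 hπ).2]
        rw [sum_congr rfl h1, sum_const, nsmul_eq_mul, ← mul_assoc]
        refine mul_le_mul_of_nonneg_right ?_ (by positivity)
        rw [hK]
        refine le_trans ?_ (card_perm_linked_le n w hw hn S)
        refine Nat.cast_le.2 (card_le_card fun π hπ => ?_)
        rw [mem_filter] at hπ ⊢
        exact ⟨mem_univ _, hπ.2.ge⟩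
    _ ≤ n.factorial * (2 * (1 + 2 * (K / n)) ^ n) := by
        rw [← mul_sum]
        exact mul_le_mul_of_nonneg_left (sum_pow_followers_le n w hx hy hKy) (by positivity)
    _ ≤ _ := by
        have h1 : (1 + 2 * (K / n)) ^ n ≤ Real.exp (2 * (K / n)) ^ n := by
          refine pow_le_pow_left₀ (by positivity) ?_ n
          rw [add_comm]
          exact Real.add_one_le_exp _
        have h2 : Real.exp (2 * (K / n)) ^ n = Real.exp (2 * K) := by
          rw [← Real.exp_nat_mul]
          congr 1
          field_simp
        rw [h2] at h1
        gcongr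

lemma mem_cycWindow {k r n : ℕ} {σ : ZMod n → Fin n} {i : ZMod n} {x : Fin n} :
    x ∈ cycWindow k r n σ i ↔ ∃ j < k + r - 1, σ (i + (j : ZMod n)) = x := by
  simp [cycWindow, Finset.bind_def]

lemma mem_hamPowEdges {k r n : ℕ} {σ : ZMod n → Fin n} {e : Finset (Fin n)} :
    e ∈ hamPowEdges r k n σ ↔ #e = r ∧ ∃ i : ZMod n, e ⊆ cycWindow k r n σ i := by
  simp [hamPowEdges]

lemma cycNear_of_mem_cycWindow {k r n : ℕ} (σ : ZMod n ≃ Fin n) {i : ZMod n} {x y : Fin n}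
    (hx : x ∈ cycWindow k r n σ i) (hy : y ∈ cycWindow k r n σ i) :
    CycNear (k + r - 2) (σ.symm x) (σ.symm y) := by
  obtain ⟨a, ha, rfl⟩ := mem_cycWindow.1 hx
  obtain ⟨b, hb, rfl⟩ := mem_cycWindow.1 hy
  refine ⟨(a : ℤ) - b, ?_, ?_⟩
  · rw [mem_Icc]; omega
  · simp only [Equiv.symm_apply_apply]
    push_cast
    ring

lemma card_hamPowEdges_inter_le {r k n : ℕ} [NeZero n] (hr : 3 ≤ r) (σ τ : ZMod n ≃ Fin n) :
    #(hamPowEdges r k n σ ∩ hamPowEdges r k n τ) ≤ (k + r - 2).choose (r - 1) *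
      #(followers n (k + r - 2) (linkedPositions (k + r - 2) (τ.trans σ.symm))) := by
  set w := k + r - 2
  set F := followers n w (linkedPositions w (τ.trans σ.symm))
  have hsub : hamPowEdges r k n σ ∩ hamPowEdges r k n τ ⊆ F.biUnion fun l =>
      (powersetCard (r - 1) ((Icc 1 w).image fun j : ℕ => τ (l - (j : ZMod n)))).image
        (insert (τ l)) := by
    intro e he
    obtain ⟨he1, he2⟩ := mem_inter.1 he
    obtain ⟨her, s, hs⟩ := mem_hamPowEdges.1 he1
    obtain ⟨-, i, hi⟩ := mem_hamPowEdges.1 he2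
    have hJ : ((range (k + r - 1)).filter fun j : ℕ => τ (i + (j : ZMod n)) ∈ e).Nonempty := by
      obtain ⟨x, hx⟩ := card_pos.1 (by omega : 0 < #e)
      obtain ⟨j, hj, rfl⟩ := mem_cycWindow.1 (hi hx)
      exact ⟨j, mem_filter.2 ⟨mem_range.2 hj, hx⟩⟩
    obtain ⟨m, hm, hmax⟩ := exists_max_image _ id hJ
    obtain ⟨hmr, hme⟩ := mem_filter.1 hm
    rw [mem_range] at hmr
    set l := i + (m : ZMod n)
    have hback : ∀ x ∈ e.erase (τ l), ∃ d ∈ Icc 1 w, τ (l - (d : ZMod n)) = x := by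
      intro x hx
      obtain ⟨hne, hxe⟩ := mem_erase.1 hx
      obtain ⟨j, hj, rfl⟩ := mem_cycWindow.1 (hi hxe)
      have hjm : j ≤ m := hmax j (mem_filter.2 ⟨mem_range.2 hj, hxe⟩)
      have hjne : j ≠ m := by rintro rfl; exact hne rfl
      refine ⟨m - j, by rw [mem_Icc]; omega, ?_⟩
      rw [Nat.cast_sub hjm]
      congr 1
      simp only [l]
      ring
    have hcard : #(e.erase (τ l)) = r - 1 := by rw [card_erase_of_mem hme, her]
    refine mem_biUnion.2 ⟨l, ?_, mem_image.2 ⟨e.erase (τ l), mem_powersetCard.2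
      ⟨fun x hx => ?_, hcard⟩, insert_erase hme⟩⟩
    · have hnear : ∀ a b : ZMod n, τ a ∈ e → τ b ∈ e →
          CycNear w ((τ.trans σ.symm) a) ((τ.trans σ.symm) b) := fun a b ha hb =>
        cycNear_of_mem_cycWindow σ (hs ha) (hs hb)
      have hpair : ∃ d₁ ∈ Icc 1 w, ∃ d₂ ∈ Icc 1 w, d₂ < d₁ ∧
          τ (l - (d₁ : ZMod n)) ∈ e ∧ τ (l - (d₂ : ZMod n)) ∈ e := by
        obtain ⟨x, hx, y, hy, hxy⟩ := one_lt_card.1 (by omega : 1 < #(e.erase (τ l)))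
        obtain ⟨a, ha, rfl⟩ := hback x hx
        obtain ⟨b, hb, rfl⟩ := hback y hy
        rcases lt_trichotomy a b with h | rfl | h
        · exact ⟨b, hb, a, ha, h, mem_of_mem_erase hy, mem_of_mem_erase hx⟩
        · exact absurd rfl hxy
        · exact ⟨a, ha, b, hb, h, mem_of_mem_erase hx, mem_of_mem_erase hy⟩
      obtain ⟨a, ha, b, hb, hba, hae, hbe⟩ := hpair
      refine mem_filter.2 ⟨mem_filter.2 ⟨mem_univ _, a, ha, hnear _ _ hme hae⟩, b, hb,
        mem_filter.2 ⟨mem_univ _, a - b, ?_, hnear _ _ hbe ?_⟩⟩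
      · rw [mem_Icc] at ha hb ⊢; omega
      · rw [Nat.cast_sub hba.le, sub_sub, add_sub_cancel]
        exact hae
    · obtain ⟨d, hd, h⟩ := hback x hx
      exact mem_image.2 ⟨d, hd, h⟩
  rw [mul_comm]
  refine (card_le_card hsub).trans (card_biUnion_le_card_mul _ _ _ fun l _ => ?_)
  refine card_image_le.trans ?_
  rw [card_powersetCard]
  refine Nat.choose_le_choose _ (card_image_le.trans ?_)
  simp

lemma sum_prW_of_subset {n r : ℕ} (p : ℝ) {E : Finset (Finset (Fin n))} (hE : E ⊆ rSets n r) :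
    ∑ H ∈ (rSets n r).powerset, (if E ⊆ H then prW n r p H else 0) = p ^ #E := by
  rw [← sum_filter]
  have : (rSets n r).powerset.filter (E ⊆ ·) = (rSets n r \ E).powerset.image (E ∪ ·) := by
    rw [← Icc_eq_image_powerset hE]
    ext H
    simp [and_comm]
  rw [this, sum_image]
  · calc _ = ∑ t ∈ (rSets n r \ E).powerset,
          p ^ #E * (p ^ #t * (1 - p) ^ (#(rSets n r \ E) - #t)) := by
          refine sum_congr rfl fun t ht => ?_
          have hd : Disjoint E t :=
            disjoint_of_subset_right (mem_powerset.1 ht) disjoint_sdiff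
          rw [prW, card_union_of_disjoint hd, card_sdiff_of_subset hE, pow_add, mul_assoc,
            Nat.sub_sub]
      _ = _ := by
          rw [← mul_sum, sum_pow_mul_eq_add_pow]
          simp
  · intro s hs t ht hst
    have h1 : Disjoint E s :=
      disjoint_of_subset_right (mem_powerset.1 (mem_coe.1 hs)) disjoint_sdiff
    have h2 : Disjoint E t :=
      disjoint_of_subset_right (mem_powerset.1 (mem_coe.1 ht)) disjoint_sdiff
    have := congrArg (· \ E) hst
    simpa [union_sdiff_left, sdiff_eq_self_of_disjoint h1.symm,
      sdiff_eq_self_of_disjoint h2.symm] using this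

lemma hamPowEdges_subset_rSets (r k n : ℕ) (σ : ZMod n → Fin n) :
    hamPowEdges r k n σ ⊆ rSets n r := fun e he => by
  obtain ⟨h, -⟩ := mem_hamPowEdges.1 he
  exact mem_filter.2 ⟨mem_univ _, h⟩

/-- Second moment bound, for the number of orderings `σ` with `hamPowEdges r k n σ ⊆ H`, each
weighted by the inverse of the probability of this event. -/
lemma inv_le_probOf_containsHamPow {r k n : ℕ} [NeZero n] {p B : ℝ} (hp : 0 < p) (hp1 : p ≤ 1)
    (hB : 0 < B) (h : ∀ σ : ZMod n ≃ Fin n, ∑ τ : ZMod n ≃ Fin n,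
      p⁻¹ ^ #(hamPowEdges r k n σ ∩ hamPowEdges r k n τ) ≤ n.factorial * B) :
    B⁻¹ ≤ probOf n r p (containsHamPow r k n) := by
  set R := (rSets n r).powerset
  set E : (ZMod n ≃ Fin n) → Finset (Finset (Fin n)) := fun σ => hamPowEdges r k n σ
  set X : Finset (Finset (Fin n)) → ℝ := fun H =>
    ∑ σ : ZMod n ≃ Fin n, if E σ ⊆ H then p⁻¹ ^ #(E σ) else 0
  have hE : ∀ σ, E σ ⊆ rSets n r := fun σ => hamPowEdges_subset_rSets r k n σ
  have hcard : (#(univ : Finset (ZMod n ≃ Fin n)) : ℝ) = n.factorial := by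
    rw [card_univ, Fintype.card_equiv (ZMod.finEquiv n).toEquiv.symm, ZMod.card]
  have hprW : ∀ H, 0 ≤ prW n r p H := fun H =>
    mul_nonneg (pow_nonneg hp.le _) (pow_nonneg (by linarith) _)
  have hmean : ∑ H ∈ R, prW n r p H * X H = n.factorial := by
    calc _ = ∑ σ : ZMod n ≃ Fin n, p⁻¹ ^ #(E σ) *
          ∑ H ∈ R, (if E σ ⊆ H then prW n r p H else 0) := by
          simp only [X, mul_sum]
          rw [sum_comm]
          refine sum_congr rfl fun σ _ => sum_congr rfl fun H _ => ?_
          split_ifs <;> ring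
      _ = ∑ σ : ZMod n ≃ Fin n, 1 := by
          refine sum_congr rfl fun σ _ => ?_
          rw [sum_prW_of_subset p (hE σ), ← mul_pow, inv_mul_cancel₀ hp.ne', one_pow]
      _ = _ := by rw [sum_const, nsmul_eq_mul, mul_one, hcard]
  have hsecond : ∑ H ∈ R, prW n r p H * X H ^ 2 ≤ n.factorial * (n.factorial * B) := by
    calc _ = ∑ σ : ZMod n ≃ Fin n, ∑ τ : ZMod n ≃ Fin n, p⁻¹ ^ #(E σ) * p⁻¹ ^ #(E τ) *
          ∑ H ∈ R, (if E σ ∪ E τ ⊆ H then prW n r p H else 0) := by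
          simp only [X, sq, mul_sum]
          rw [sum_comm]
          refine sum_congr rfl fun σ _ => ?_
          simp only [sum_mul, mul_sum]
          rw [sum_comm]
          refine sum_congr rfl fun τ _ => sum_congr rfl fun H _ => ?_
          simp only [union_subset_iff]
          by_cases h1 : E σ ⊆ H <;> by_cases h2 : E τ ⊆ H <;> simp [h1, h2]
          ring
      _ = ∑ σ : ZMod n ≃ Fin n, ∑ τ : ZMod n ≃ Fin n, p⁻¹ ^ #(E σ ∩ E τ) := by
          refine sum_congr rfl fun σ _ => sum_congr rfl fun τ _ => ?_
          rw [sum_prW_of_subset p (union_subset (hE σ) (hE τ)), ← pow_add,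
            ← card_union_add_card_inter, pow_add, mul_right_comm, ← mul_pow,
            inv_mul_cancel₀ hp.ne', one_pow, one_mul]
      _ ≤ ∑ σ : ZMod n ≃ Fin n, n.factorial * B := sum_le_sum fun σ _ => h σ
      _ = _ := by rw [sum_const, nsmul_eq_mul, hcard]
  have hcs := sum_sq_le_sum_mul_sum_of_sq_le_mul R (r := fun H => prW n r p H * X H)
    (f := fun H => if containsHamPow r k n H then prW n r p H else 0)
    (g := fun H => prW n r p H * X H ^ 2)
    (fun H _ => by split_ifs <;> [exact hprW H; exact le_rfl])
    (fun H _ => mul_nonneg (hprW H) (sq_nonneg _))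
    (fun H _ => by
      by_cases hH : containsHamPow r k n H
      · simp only [hH, if_true]; exact le_of_eq (by ring)
      · have hX : X H = 0 := sum_eq_zero fun σ _ => if_neg fun hσ => hH ⟨σ, σ.bijective, hσ⟩
        simp [hX])
  rw [hmean] at hcs
  have hP : 0 ≤ probOf n r p (containsHamPow r k n) := sum_nonneg fun H _ => by
    split_ifs <;> [exact hprW H; exact le_rfl]
  have hf : (0 : ℝ) < n.factorial := by positivity
  change _ ≤ probOf n r p (containsHamPow r k n) * _ at hcs
  have hfin := hcs.trans (mul_le_mul_of_nonneg_left hsecond hP)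
  rw [inv_le_iff_one_le_mul₀ hB]
  refine le_of_mul_le_mul_left ?_ (mul_pos hf hf)
  linarith

lemma add_sq_le_choose_mul {m : ℕ} (hm : 2 ≤ m) (t : ℕ) :
    (m + t) ^ 2 ≤ (m + t).choose m * (m + 1) ^ 2 := by
  induction t with
  | zero => simp; nlinarith
  | succ t ih =>
    have h := Nat.choose_mul_succ_eq (m + t) m
    rw [show m + t + 1 - m = t + 1 by omega] at h
    refine Nat.le_of_mul_le_mul_right ?_ (Nat.succ_pos t)
    have h1 : (t + 1) * (m + t + 1) ≤ (m + t) ^ 2 := by nlinarith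
    calc (m + (t + 1)) ^ 2 * (t + 1) = (m + t + 1) * ((t + 1) * (m + t + 1)) := by ring
      _ ≤ (m + t + 1) * (m + t) ^ 2 := Nat.mul_le_mul_left _ h1
      _ ≤ (m + t + 1) * ((m + t).choose m * (m + 1) ^ 2) := Nat.mul_le_mul_left _ ih
      _ = (m + t).choose m * (m + t + 1) * (m + 1) ^ 2 := by ring
      _ = (m + (t + 1)).choose m * (m + 1) ^ 2 * (t + 1) := by rw [h]; ring_nf

/-- The hypothesis on `C` in the main theorem, in the form in which it is used. -/
lemma two_mul_le_pow_of_le {r k : ℕ} (hr : 3 ≤ r) (hk : 1 ≤ k) {C : ℝ}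
    (hC : 4 * Real.exp 1 * (r : ℝ) ^ 2 * ((k + r - 2).choose (r - 1)) *
      ((2 * (k : ℝ) + 2 * r - 3) * Real.exp 1) ^
        ((1 : ℝ) / ((k + r - 2).choose (r - 1))) ≤ C) :
    0 < C ∧ 2 * (Real.exp 2 * (((k + r - 2 : ℕ) : ℝ) * (2 * ((k + r - 2 : ℕ) : ℝ) + 1))) *
      ((k + r - 2 : ℕ) : ℝ) ≤ C ^ (k + r - 2).choose (r - 1) := by
  have hsq := add_sq_le_choose_mul (m := r - 1) (by omega) (k - 1)
  rw [show r - 1 + (k - 1) = k + r - 2 by omega, show r - 1 + 1 = r by omega] at hsq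
  have hd1 : 1 ≤ (k + r - 2).choose (r - 1) := Nat.choose_pos (by omega)
  have hwc : ((k + r - 2 : ℕ) : ℝ) = k + r - 2 := by
    rw [Nat.cast_sub (by omega)]; push_cast; ring
  rw [show 2 * (k : ℝ) + 2 * r - 3 = 2 * ((k + r - 2 : ℕ) : ℝ) + 1 by rw [hwc]; ring] at hC
  set d := (k + r - 2).choose (r - 1)
  set w := k + r - 2
  have he : 1 ≤ Real.exp 1 := Real.one_le_exp zero_le_one
  have hsqR : (w : ℝ) ^ 2 ≤ d * (r : ℝ) ^ 2 := by exact_mod_cast hsq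
  have hdR : (1 : ℝ) ≤ d := by exact_mod_cast hd1
  have hrR : (3 : ℝ) ≤ r := by exact_mod_cast hr
  set a := 4 * Real.exp 1 * (r : ℝ) ^ 2 * d with ha
  set b := (2 * (w : ℝ) + 1) * Real.exp 1 with hb
  have hb0 : 0 < b := by positivity
  have ha1 : 1 ≤ a := by
    have h1 : (1 : ℝ) ≤ 4 * Real.exp 1 := by linarith
    have h2 : (1 : ℝ) ≤ (r : ℝ) ^ 2 := one_le_pow₀ (by linarith)
    exact one_le_mul_of_one_le_of_one_le (one_le_mul_of_one_le_of_one_le h1 h2) hdR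
  have hab : 0 < a * b ^ ((1 : ℝ) / d) := by positivity
  refine ⟨hab.trans_le hC, ?_⟩
  have hbd : (b ^ ((1 : ℝ) / d)) ^ d = b := by
    rw [one_div]
    exact Real.rpow_inv_natCast_pow hb0.le (by omega)
  have hpow : a * b ≤ C ^ d := by
    calc a * b ≤ a ^ d * b :=
          mul_le_mul_of_nonneg_right (le_self_pow₀ ha1 (by omega)) hb0.le
      _ = (a * b ^ ((1 : ℝ) / d)) ^ d := by rw [mul_pow a, hbd]
      _ ≤ C ^ d := pow_le_pow_left₀ hab.le hC d
  refine le_trans ?_ hpow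
  have he2 : Real.exp 2 = Real.exp 1 * Real.exp 1 := by rw [← Real.exp_add]; norm_num
  have hmul : 0 ≤ 4 * Real.exp 1 * Real.exp 1 * (2 * (w : ℝ) + 1) := by positivity
  have h3 := mul_le_mul_of_nonneg_left hsqR hmul
  have h4 : 0 ≤ Real.exp 1 * Real.exp 1 * (2 * (w : ℝ) + 1) * (w : ℝ) ^ 2 := by positivity
  rw [he2, ha, hb]
  linarith

lemma eventually_mul_log_le (w : ℕ) : ∀ᶠ n : ℕ in Filter.atTop, w * Real.log n ≤ n := by
  have hc : (0 : ℝ) < 1 / (w + 1) := by positivity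
  filter_upwards [(Real.isLittleO_log_id_atTop.comp_tendsto
    (tendsto_natCast_atTop_atTop (R := ℝ))).bound hc] with n hn
  have h0 : 0 ≤ Real.log n := Real.log_natCast_nonneg n
  simp only [Function.comp_apply, id_eq, Real.norm_eq_abs, abs_of_nonneg h0, Nat.abs_cast] at hn
  rw [one_div, inv_mul_eq_div, le_div_iff₀ (by positivity)] at hn
  linarith

theorem stmt1 (r k : ℕ) (hr : 3 ≤ r) (hk : 1 ≤ k) :
    ∃ δ : ℝ, 0 < δ ∧ ∀ C : ℝ,
      4 * Real.exp 1 * (r : ℝ) ^ 2 * ((k + r - 2).choose (r - 1)) *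
          ((2 * (k : ℝ) + 2 * r - 3) * Real.exp 1) ^
            ((1 : ℝ) / ((k + r - 2).choose (r - 1))) ≤ C →
      ∃ N : ℕ, ∀ n ≥ N,
        δ ≤ probOf n r (C * (n : ℝ) ^ (-(1 : ℝ) / ((k + r - 2).choose (r - 1))))
              (containsHamPow r k n) := by
  set w := k + r - 2 with hw
  set d := w.choose (r - 1) with hd
  set K : ℝ := Real.exp 2 * (w * (2 * w + 1)) with hK
  refine ⟨(2 * Real.exp (2 * K))⁻¹, by positivity, fun C hC => ?_⟩
  obtain ⟨hC0, hCd⟩ := two_mul_le_pow_of_le hr hk hC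
  obtain ⟨N, hN⟩ := Filter.eventually_atTop.1 ((eventually_mul_log_le w).and
    (((tendsto_natCast_atTop_atTop (R := ℝ)).eventually_ge_atTop (C ^ d)).and
      (Filter.eventually_ge_atTop 1)))
  refine ⟨N, fun n hn => ?_⟩
  obtain ⟨hlog, hCn, hn1⟩ := hN n hn
  have : NeZero n := ⟨by omega⟩
  have hn0 : (0 : ℝ) < n := by exact_mod_cast hn1
  have hd0 : d ≠ 0 := (Nat.choose_pos (by omega)).ne'
  have hCd0 : 0 < C ^ d := pow_pos hC0 d
  set p := C * (n : ℝ) ^ (-(1 : ℝ) / d) with hp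
  have hp0 : 0 < p := by positivity
  have hpd : p ^ d = C ^ d / n := by
    rw [hp, mul_pow, neg_div, one_div, Real.rpow_neg hn0.le, inv_pow,
      Real.rpow_inv_natCast_pow hn0.le hd0, div_eq_mul_inv]
  have hp1 : p ≤ 1 := by
    rw [← pow_le_one_iff_of_nonneg hp0.le hd0, hpd]
    exact (div_le_one hn0).2 hCn
  have hinv : 1 ≤ p⁻¹ := (one_le_inv₀ hp0).2 hp1
  have hy : (p⁻¹) ^ d = n / C ^ d := by rw [inv_pow, hpd, inv_div]
  refine inv_le_probOf_containsHamPow hp0 hp1 (by positivity) fun σ => ?_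
  calc _ ≤ ∑ τ : ZMod n ≃ Fin n, ((p⁻¹) ^ d) ^ #(followers n w
          (linkedPositions w ((Equiv.equivCongr (Equiv.refl _) σ.symm) τ))) := by
        refine sum_le_sum fun τ _ => ?_
        rw [← pow_mul]
        exact pow_le_pow_right₀ hinv (card_hamPowEdges_inter_le hr σ τ)
    _ = ∑ π : Equiv.Perm (ZMod n), ((p⁻¹) ^ d) ^ #(followers n w (linkedPositions w π)) :=
        (Equiv.equivCongr (Equiv.refl _) σ.symm).sum_comp fun π =>
          ((p⁻¹) ^ d) ^ #(followers n w (linkedPositions w π))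
    _ ≤ _ := by
        refine sum_pow_followers_linkedPositions_le n w (by omega) hlog hK
          (one_le_pow₀ hinv) ?_
        rw [hy, show K / n * (n / C ^ d) * w = K * w / C ^ d by field_simp, div_le_iff₀ hCd0]
        linarith

end
end

section
/- Let r ≥ 2 and k ≥ 1 be integers, let H be a copy of the kth power of a tight Hamilton cycle on n vertices, let v be a vertex of H, and let b ≥ 1. Then the number of connected subhypergraphs of H that contain v and have exactly b edges is at most e^b · r^{2b} · binom(k+r-2, r-1)^b. -/
open scoped Classical
open Finset

noncomputable section

/-- Weighting the subsets of `E` as a `p`-random subset: if no subset of `E` can contain two members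
of `𝒜` while avoiding both of their boundaries, then the corresponding events are disjoint. -/
theorem card_mul_pow_le_one {α : Type*} [DecidableEq α] (E : Finset α)
    (𝒜 : Finset (Finset α)) (bd : Finset α → Finset α) (b m : ℕ) (p : ℝ)
    (hp : 0 ≤ p) (hp1 : p ≤ 1) (hsub : ∀ S ∈ 𝒜, S ⊆ E) (hcard : ∀ S ∈ 𝒜, S.card = b)
    (hbd : ∀ S ∈ 𝒜, bd S ⊆ E \ S) (hbdcard : ∀ S ∈ 𝒜, (bd S).card ≤ m)
    (hdisj : ∀ S ∈ 𝒜, ∀ T ∈ 𝒜, ∀ R, S ⊆ R → T ⊆ R → Disjoint R (bd S) →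
      Disjoint R (bd T) → S = T) :
    (𝒜.card : ℝ) * (p ^ b * (1 - p) ^ m) ≤ 1 := by
  have hq : 0 ≤ 1 - p := by linarith
  have hevent : ∀ S ∈ 𝒜, p ^ b * (1 - p) ^ m ≤
      ∑ R ∈ Icc S (E \ bd S), p ^ R.card * (1 - p) ^ (E.card - R.card) := by
    intro S hS
    have hSb : S ⊆ E \ bd S := by
      intro x hx
      refine mem_sdiff.2 ⟨hsub S hS hx, fun h => ?_⟩
      exact (mem_sdiff.1 (hbd S hS h)).2 hx
    have hbE : bd S ⊆ E := (hbd S hS).trans sdiff_subset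
    have hcE : ((E \ bd S) \ S).card + b + (bd S).card = E.card := by
      rw [← hcard S hS, card_sdiff_add_card_eq_card hSb, card_sdiff_add_card_eq_card hbE]
    have hdU : ∀ U ∈ ((E \ bd S) \ S).powerset, Disjoint S U := fun U hU =>
      (disjoint_sdiff (s := S) (t := E \ bd S)).mono_right (mem_powerset.1 hU)
    rw [Icc_eq_image_powerset hSb, sum_image]
    · have : ∀ U ∈ ((E \ bd S) \ S).powerset,
          p ^ (S ∪ U).card * (1 - p) ^ (E.card - (S ∪ U).card) =
          p ^ b * (1 - p) ^ (bd S).card *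
            (p ^ U.card * (1 - p) ^ (((E \ bd S) \ S).card - U.card)) := by
        intro U hU
        have hle := card_le_card (mem_powerset.1 hU)
        rw [card_union_of_disjoint (hdU U hU), hcard S hS,
          show E.card - (b + U.card) = (bd S).card + (((E \ bd S) \ S).card - U.card) by omega]
        ring
      rw [sum_congr rfl this, ← mul_sum, sum_pow_mul_eq_add_pow]
      simp only [add_sub_cancel, one_pow, mul_one]
      exact mul_le_mul_of_nonneg_left
        (pow_le_pow_of_le_one hq (by linarith) (hbdcard S hS)) (pow_nonneg hp _)
    · intro U hU V hV h
      have h' : S ∪ U = S ∪ V := h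
      rw [← union_sdiff_cancel_left (hdU U hU), h', union_sdiff_cancel_left (hdU V hV)]
  calc (𝒜.card : ℝ) * (p ^ b * (1 - p) ^ m)
      = ∑ S ∈ 𝒜, p ^ b * (1 - p) ^ m := by simp
    _ ≤ ∑ S ∈ 𝒜, ∑ R ∈ Icc S (E \ bd S), p ^ R.card * (1 - p) ^ (E.card - R.card) :=
        sum_le_sum hevent
    _ = ∑ R ∈ 𝒜.biUnion fun S => Icc S (E \ bd S),
          p ^ R.card * (1 - p) ^ (E.card - R.card) := by
        refine (sum_biUnion ?_).symm
        intro S hS T hT hne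
        refine disjoint_left.2 fun R hRS hRT => hne ?_
        obtain ⟨h1, h2⟩ := mem_Icc.1 hRS
        obtain ⟨h3, h4⟩ := mem_Icc.1 hRT
        exact hdisj S hS T hT R h1 h3 (disjoint_sdiff_self_left.mono_left h2)
          (disjoint_sdiff_self_left.mono_left h4)
    _ ≤ ∑ R ∈ E.powerset, p ^ R.card * (1 - p) ^ (E.card - R.card) := by
        refine sum_le_sum_of_subset_of_nonneg ?_ fun R _ _ =>
          mul_nonneg (pow_nonneg hp _) (pow_nonneg hq _)
        intro R hR
        obtain ⟨S, _, hRS⟩ := mem_biUnion.1 hR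
        exact mem_powerset.2 ((mem_Icc.1 hRS).2.trans sdiff_subset)
    _ = 1 := by rw [sum_pow_mul_eq_add_pow]; simp

theorem le_exp_mul_pow_of_mul_le_one (N : ℝ) (b D : ℕ) (hD : 2 ≤ D)
    (h : N * ((1 / (D : ℝ)) ^ b * (1 - 1 / (D : ℝ)) ^ (b * (D - 1))) ≤ 1) :
    N ≤ Real.exp 1 ^ b * (D : ℝ) ^ b := by
  obtain ⟨d, rfl⟩ : ∃ d, D = d + 1 := ⟨D - 1, by omega⟩
  have hd : (0 : ℝ) < d := by exact_mod_cast (show 0 < d by omega)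
  have hD' : (0 : ℝ) < ((d + 1 : ℕ) : ℝ) := by positivity
  have hfrac : 1 - 1 / ((d + 1 : ℕ) : ℝ) = (1 + 1 / (d : ℝ))⁻¹ := by
    push_cast
    field_simp
    ring
  have hexp : (1 + 1 / (d : ℝ)) ^ d ≤ Real.exp 1 := by
    calc (1 + 1 / (d : ℝ)) ^ d ≤ Real.exp (1 / d) ^ d := by
          gcongr
          linarith [Real.add_one_le_exp (1 / (d : ℝ))]
      _ = Real.exp 1 := by
          rw [← Real.exp_nat_mul]
          congr 1
          field_simp
  rw [hfrac, Nat.add_sub_cancel, one_div, inv_pow, inv_pow, ← mul_inv, ← div_eq_mul_inv,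
    div_le_one (by positivity)] at h
  calc N ≤ ((d + 1 : ℕ) : ℝ) ^ b * (1 + 1 / (d : ℝ)) ^ (b * d) := h
    _ = ((1 + 1 / (d : ℝ)) ^ d) ^ b * ((d + 1 : ℕ) : ℝ) ^ b := by
        rw [← pow_mul, mul_comm d b, mul_comm]
    _ ≤ Real.exp 1 ^ b * ((d + 1 : ℕ) : ℝ) ^ b := by gcongr

/-- Every edge of the `k`th power of a tight Hamilton cycle has a first vertex, with the remaining
ones among the following `k + r - 2`. -/
theorem exists_offsets_of_mem_hamPowEdges {r k n : ℕ} (hr : 2 ≤ r) {σ : ZMod n → Fin n}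
    {e : Finset (Fin n)} (he : e ∈ hamPowEdges r k n σ) :
    ∃ i : ZMod n, ∃ J ∈ powersetCard (r - 1) (Icc 1 (k + r - 2)),
      e = (insert 0 J).image fun j : ℕ => σ (i + (j : ZMod n)) := by
  obtain ⟨hcard, i, hi⟩ := (mem_filter.1 he).2
  have hsurj : Set.SurjOn (fun j : ℕ => σ (i + (j : ZMod n)))
      (Finset.range (k + r - 1) : Set ℕ) e := by
    intro x hx
    simpa [cycWindow] using hi hx
  obtain ⟨u, hu, hinj, rfl⟩ := exists_subset_injOn_image_eq_of_surjOn _ _ hsurj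
  rw [card_image_of_injOn hinj] at hcard
  have hne : u.Nonempty := card_pos.1 (by omega)
  set m := u.min' hne with hm
  have hmu : m ∈ u := u.min'_mem hne
  have hlt : ∀ x ∈ u, x < k + r - 1 := fun x hx => mem_range.1 (hu hx)
  have hle : ∀ x ∈ u, m ≤ x := fun x hx => u.min'_le x hx
  refine ⟨i + (m : ZMod n), (u.erase m).image (· - m), mem_powersetCard.2 ⟨?_, ?_⟩, ?_⟩
  · intro y hy
    obtain ⟨x, hx, rfl⟩ := mem_image.1 hy
    obtain ⟨hxm, hxu⟩ := mem_erase.1 hx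
    have := hlt x hxu
    have := hle x hxu
    exact mem_Icc.2 (by omega)
  · rw [card_image_of_injOn, card_erase_of_mem hmu, hcard]
    intro x hx y hy hxy
    have := hle x (mem_of_mem_erase hx)
    have := hle y (mem_of_mem_erase hy)
    have : x - m = y - m := hxy
    omega
  · have hins : insert 0 ((u.erase m).image (· - m)) = u.image (· - m) := by
      conv_rhs => rw [← insert_erase hmu, image_insert, Nat.sub_self]
    rw [hins, image_image]
    refine image_congr fun x hx => ?_
    simp only [Function.comp_apply]
    rw [add_assoc, ← Nat.cast_add, Nat.add_sub_cancel' (hle x hx)]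

theorem degOf_hamPowEdges_le {r k n : ℕ} (hr : 2 ≤ r) {σ : ZMod n → Fin n}
    (hσ : Function.Injective σ) (v : Fin n) :
    degOf n (hamPowEdges r k n σ) v ≤ r * (k + r - 2).choose (r - 1) := by
  have : Nonempty (ZMod n) := ⟨0⟩
  have hsub : (hamPowEdges r k n σ).filter (fun e => v ∈ e) ⊆
      (powersetCard (r - 1) (Icc 1 (k + r - 2))).biUnion fun J =>
        (insert 0 J).image fun t : ℕ => (insert 0 J).image fun j : ℕ =>
          σ (Function.invFun σ v - (t : ZMod n) + (j : ZMod n)) := by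
    intro e he
    obtain ⟨he, hv⟩ := mem_filter.1 he
    obtain ⟨i, J, hJ, rfl⟩ := exists_offsets_of_mem_hamPowEdges hr he
    obtain ⟨t, ht, rfl⟩ := mem_image.1 hv
    refine mem_biUnion.2 ⟨J, hJ, mem_image.2 ⟨t, ht, ?_⟩⟩
    simp only [Function.leftInverse_invFun hσ _, add_sub_cancel_right]
  refine (card_le_card hsub).trans ((card_biUnion_le_card_mul _ _ r fun J hJ => ?_).trans ?_)
  · refine card_image_le.trans ((card_insert_le _ _).trans ?_)
    rw [(mem_powersetCard.1 hJ).2]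
    omega
  · rw [card_powersetCard, Nat.card_Icc, Nat.add_sub_cancel, mul_comm]

/-- A set closed under adjacency within `T` that meets the connected edge set `T` contains `T`. -/
theorem subset_of_numComp_eq_one {n : ℕ} {S T : Finset (Finset (Fin n))} (hT : numComp T = 1)
    {e : Finset (Fin n)} (heS : e ∈ S) (heT : e ∈ T)
    (hclosed : ∀ f ∈ S, ∀ g ∈ T, (f ∩ g).Nonempty → g ∈ S) : T ⊆ S := by
  have hsub := (Nat.card_eq_one_iff_unique.1 hT).1
  intro g hg
  have hreach : (edgeGraph T).Reachable ⟨e, heT⟩ ⟨g, hg⟩ :=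
    SimpleGraph.ConnectedComponent.exact (Subsingleton.elim _ _)
  rw [SimpleGraph.reachable_iff_reflTransGen] at hreach
  have key : ∀ x, Relation.ReflTransGen (edgeGraph T).Adj ⟨e, heT⟩ x → x.1 ∈ S := by
    intro x hx
    induction hx with
    | refl => exact heS
    | @tail y z _ hyz ih =>
      obtain ⟨_, h | h⟩ := (SimpleGraph.fromRel_adj _ _ _).1 hyz
      · exact hclosed _ ih _ z.2 h
      · exact hclosed _ ih _ z.2 (by rwa [inter_comm])
  exact key _ hreach

/-- The edges of `E` outside `S` that share a vertex with an edge of `S`. -/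
def edgeBoundary {n : ℕ} (E S : Finset (Finset (Fin n))) : Finset (Finset (Fin n)) :=
  (E \ S).filter fun g => ∃ f ∈ S, (f ∩ g).Nonempty

theorem card_edgeBoundary_le {n r d : ℕ} (hr : 1 ≤ r) {E S : Finset (Finset (Fin n))}
    (hSE : S ⊆ E) (hE : ∀ e ∈ E, e.card = r) (hdeg : ∀ v, degOf n E v ≤ d) :
    (edgeBoundary E S).card ≤ S.card * (r * d - 1) := by
  have hsub : edgeBoundary E S ⊆
      S.biUnion fun f => (f.biUnion fun v => E.filter fun e => v ∈ e).erase f := by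
    intro g hg
    obtain ⟨hgE, f, hf, x, hx⟩ := mem_filter.1 hg
    obtain ⟨hgE, hgS⟩ := mem_sdiff.1 hgE
    obtain ⟨hxf, hxg⟩ := mem_inter.1 hx
    refine mem_biUnion.2 ⟨f, hf, mem_erase.2 ⟨?_, ?_⟩⟩
    · rintro rfl
      exact hgS hf
    · exact mem_biUnion.2 ⟨x, hxf, mem_filter.2 ⟨hgE, hxg⟩⟩
  refine (card_le_card hsub).trans (card_biUnion_le_card_mul _ _ _ fun f hf => ?_)
  have hfr := hE f (hSE hf)
  obtain ⟨x, hx⟩ : f.Nonempty := card_pos.1 (by omega)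
  rw [card_erase_of_mem (mem_biUnion.2 ⟨x, hx, mem_filter.2 ⟨hSE hf, hx⟩⟩), ← hfr]
  exact Nat.sub_le_sub_right (card_biUnion_le_card_mul _ _ _ fun v _ => hdeg v) 1

/-- A connected set of edges containing `v` is the component of `v` in any larger edge set that
avoids its boundary. -/
theorem subset_of_disjoint_edgeBoundary {n : ℕ} {E S T R : Finset (Finset (Fin n))} {v : Fin n}
    (hTE : T ⊆ E) (hT : numComp T = 1) (hvS : v ∈ vertsOf S) (hvT : v ∈ vertsOf T)
    (hTR : T ⊆ R) (hR : Disjoint R (edgeBoundary E S)) : T ⊆ S := by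
  obtain ⟨f, hf, hvf⟩ := mem_biUnion.1 hvS
  obtain ⟨g, hg, hvg⟩ := mem_biUnion.1 hvT
  have hclosed : ∀ f ∈ S, ∀ g ∈ T, (f ∩ g).Nonempty → g ∈ S := by
    intro f hf g hg hfg
    by_contra hgS
    exact disjoint_left.1 hR (hTR hg)
      (mem_filter.2 ⟨mem_sdiff.2 ⟨hTE hg, hgS⟩, f, hf, hfg⟩)
  exact subset_of_numComp_eq_one hT (hclosed f hf g hg ⟨v, mem_inter.2 ⟨hvf, hvg⟩⟩) hg hclosed

theorem stmt7 (r k n b : ℕ) (hr : 2 ≤ r) (hk : 1 ≤ k) (hb : 1 ≤ b)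
    (σ : ZMod n → Fin n) (hσ : Function.Bijective σ) (v : Fin n) :
    (((hamPowEdges r k n σ).powerset.filter fun P =>
        v ∈ vertsOf P ∧ P.card = b ∧ numComp P = 1).card : ℝ)
      ≤ Real.exp 1 ^ b * (r : ℝ) ^ (2 * b) * (((k + r - 2).choose (r - 1) : ℝ)) ^ b := by
  set C := (k + r - 2).choose (r - 1) with hC
  have hCpos : 1 ≤ C := Nat.choose_pos (by omega)
  have hD : 2 ≤ r * (r * C) :=
    hr.trans (Nat.le_mul_of_pos_right r (Nat.mul_pos (by omega) hCpos))
  have hp1 : 1 / ((r * (r * C) : ℕ) : ℝ) ≤ 1 := by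
    rw [div_le_one (by exact_mod_cast (by omega : 0 < r * (r * C)))]
    exact_mod_cast (by omega : 1 ≤ r * (r * C))
  have hcount := card_mul_pow_le_one (hamPowEdges r k n σ)
    ((hamPowEdges r k n σ).powerset.filter fun P =>
        v ∈ vertsOf P ∧ P.card = b ∧ numComp P = 1)
    (edgeBoundary (hamPowEdges r k n σ)) b (b * (r * (r * C) - 1))
    (1 / ((r * (r * C) : ℕ) : ℝ)) (by positivity) hp1
    (fun S hS => mem_powerset.1 (mem_filter.1 hS).1)
    (fun S hS => (mem_filter.1 hS).2.2.1)
    (fun S _ => filter_subset _ _)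
    (fun S hS => by
      obtain ⟨hSE, -, hSb, -⟩ := mem_filter.1 hS
      rw [← hSb]
      exact card_edgeBoundary_le (by omega) (mem_powerset.1 hSE)
        (fun e he => (mem_filter.1 he).2.1) fun v => degOf_hamPowEdges_le hr hσ.injective v)
    (fun S hS T hT R hSR hTR hRS hRT => by
      obtain ⟨hSE, hvS, -, hS1⟩ := mem_filter.1 hS
      obtain ⟨hTE, hvT, -, hT1⟩ := mem_filter.1 hT
      exact (subset_of_disjoint_edgeBoundary (mem_powerset.1 hSE) hS1 hvT hvS hSR hRT).antisymm
        (subset_of_disjoint_edgeBoundary (mem_powerset.1 hTE) hT1 hvS hvT hTR hRS))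
  refine (le_exp_mul_pow_of_mul_le_one _ b _ hD hcount).trans_eq ?_
  push_cast
  ring

end
end

section
/- Let G be a (simple) graph with maximum degree Δ, let v be a vertex of G, and let b ≥ 1. Then the number of connected subgraphs of G that contain v and have exactly b edges is at most (eΔ)^b. -/
open scoped Classical
open Finset

noncomputable section

/-- Every nonempty `T ⊆ P` meets `A` or an edge of `P \ T`: each component of `P` meets `A`. -/
def EachComponentMeets {V : Type*} (A : Finset V) (P : Finset (Sym2 V)) : Prop :=
  ∀ T ⊆ P, T.Nonempty → ∃ e ∈ T, ∃ x ∈ e, x ∈ A ∨ ∃ f ∈ P, f ∉ T ∧ x ∈ f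

/-- The vertices of `A`, together with the neighbours of `u` along edges of `S`, without `u`. -/
def exploreVertex {V : Type*} (A : Finset V) (u : V) (S : Finset (Sym2 V)) : Finset V :=
  A.erase u ∪ S.biUnion fun e => e.toFinset.erase u

theorem card_exploreVertex_lt {V : Type*} {A : Finset V} {u : V} {S : Finset (Sym2 V)}
    (hu : u ∈ A) (hS : ∀ e ∈ S, u ∈ e) : (exploreVertex A u S).card < A.card + S.card := by
  have h1 : (A.erase u).card + 1 = A.card := Finset.card_erase_add_one hu
  have h2 : (S.biUnion fun e => e.toFinset.erase u).card ≤ S.card * 1 := by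
    refine Finset.card_biUnion_le_card_mul _ _ _ fun e he => ?_
    have h3 : (e.toFinset.erase u).card + 1 = e.toFinset.card :=
      Finset.card_erase_add_one (Sym2.mem_toFinset.2 (hS e he))
    have h4 : e.toFinset.card ≤ 2 := by
      rw [Sym2.card_toFinset]; split_ifs <;> omega
    omega
  have h5 := Finset.card_union_le (A.erase u) (S.biUnion fun e => e.toFinset.erase u)
  unfold exploreVertex
  omega

theorem EachComponentMeets.explore {V : Type*} {A : Finset V} {P : Finset (Sym2 V)}
    (h : EachComponentMeets A P) (u : V) :
    EachComponentMeets (exploreVertex A u (P.filter fun e => u ∈ e))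
      (P.filter fun e => u ∉ e) := by
  intro T hT hne
  obtain ⟨e, he, x, hx, hxA⟩ := h T (hT.trans (Finset.filter_subset _ _)) hne
  have hue : u ∉ e := (Finset.mem_filter.1 (hT he)).2
  have hxu : x ≠ u := fun hxu => hue (hxu ▸ hx)
  refine ⟨e, he, x, hx, ?_⟩
  rcases hxA with hxA | ⟨f, hf, hfT, hxf⟩
  · exact Or.inl (Finset.mem_union_left _ (Finset.mem_erase.2 ⟨hxu, hxA⟩))
  · by_cases huf : u ∈ f
    · refine Or.inl (Finset.mem_union_right _ (Finset.mem_biUnion.2 ⟨f, ?_, ?_⟩))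
      · exact Finset.mem_filter.2 ⟨hf, huf⟩
      · exact Finset.mem_erase.2 ⟨hxu, Sym2.mem_toFinset.2 hxf⟩
    · exact Or.inr ⟨f, Finset.mem_filter.2 ⟨hf, huf⟩, hfT, hxf⟩

/-- The Vandermonde identity, as an upper bound for a sum over subsets. -/
theorem sum_powerset_choose_le {α : Type*} (E : Finset α) (M b : ℕ) :
    ∑ S ∈ E.powerset, (if S.card ≤ b then M.choose (b - S.card) else 0)
      ≤ (E.card + M).choose b := by
  rw [Finset.sum_powerset_apply_card fun j => if j ≤ b then M.choose (b - j) else 0,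
    Nat.add_choose_eq, Finset.Nat.sum_antidiagonal_eq_sum_range_succ_mk]
  simp only [smul_eq_mul, mul_ite, mul_zero]
  rw [← Finset.sum_filter]
  refine Finset.sum_le_sum_of_subset fun j hj => ?_
  simp only [Finset.mem_filter, Finset.mem_range] at hj ⊢
  omega

/-- Counting by exploration: revealing the edges at one vertex of `A` after another takes at
most `m` steps, each of which reveals the status of at most `d` edges. -/
theorem card_eachComponentMeets_le {V : Type*} (d m : ℕ) (A : Finset V)
    (D : Finset (Sym2 V)) (b : ℕ) (hD : ∀ u, (D.filter fun e => u ∈ e).card ≤ d)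
    (hAb : A.card + b ≤ m + 1) :
    (D.powerset.filter fun P => P.card = b ∧ EachComponentMeets A P).card
      ≤ (m * d).choose b := by
  rcases Nat.eq_zero_or_pos b with rfl | hb
  · rw [Nat.choose_zero_right]
    refine Finset.card_le_one.2 fun P hP Q hQ => ?_
    rw [Finset.card_eq_zero.1 (Finset.mem_filter.1 hP).2.1,
      Finset.card_eq_zero.1 (Finset.mem_filter.1 hQ).2.1]
  rcases A.eq_empty_or_nonempty with rfl | ⟨u, hu⟩
  · refine (Finset.card_eq_zero.2 (Finset.filter_eq_empty_iff.2 ?_)).trans_le (Nat.zero_le _)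
    rintro P - ⟨hPb, hP⟩
    obtain ⟨e, -, x, -, hx | ⟨f, hf, hf', -⟩⟩ :=
      hP P subset_rfl (Finset.card_pos.1 (hPb ▸ hb))
    · exact Finset.notMem_empty _ hx
    · exact hf' hf
  have hA : 0 < A.card := Finset.card_pos.2 ⟨u, hu⟩
  match m with
  | 0 => omega
  | m + 1 =>
    set E := D.filter fun e => u ∈ e
    have hmaps : ∀ P ∈ D.powerset.filter (fun P => P.card = b ∧ EachComponentMeets A P),
        (P.filter fun e => u ∈ e) ∈ E.powerset := fun P hP =>
      Finset.mem_powerset.2 (Finset.filter_subset_filter _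
        (Finset.mem_powerset.1 (Finset.mem_filter.1 hP).1))
    rw [Finset.card_eq_sum_card_fiberwise hmaps]
    calc _ ≤ ∑ S ∈ E.powerset,
          (if S.card ≤ b then (m * d).choose (b - S.card) else 0) := ?_
      _ ≤ (E.card + m * d).choose b := sum_powerset_choose_le _ _ _
      _ ≤ ((m + 1) * d).choose b := Nat.choose_le_choose _ (by
          have hEd : E.card ≤ d := hD u
          rw [Nat.succ_mul]; omega)
    refine Finset.sum_le_sum fun S hS => ?_
    have hSu : ∀ e ∈ S, u ∈ e := fun e he =>
      (Finset.mem_filter.1 (Finset.mem_powerset.1 hS he)).2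
    split_ifs with hSb
    · have hlt := card_exploreVertex_lt hu hSu
      refine le_trans ?_ (card_eachComponentMeets_le d m (exploreVertex A u S)
        (D.filter fun e => u ∉ e) (b - S.card)
        (fun w => (Finset.card_le_card (Finset.filter_subset_filter _
          (Finset.filter_subset _ _))).trans (hD w)) (by omega))
      refine Finset.card_le_card_of_injOn (fun P => P.filter fun e => u ∉ e) ?_ ?_
      · intro P hP
        simp only [Finset.coe_filter, Finset.mem_filter, Finset.mem_powerset,
          Set.mem_ofPred_eq] at hP ⊢
        obtain ⟨⟨hPD, hPb, hPA⟩, rfl⟩ := hP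
        refine ⟨Finset.filter_subset_filter _ hPD, ?_, hPA.explore u⟩
        have := Finset.card_filter_add_card_filter_not (s := P) (fun e => u ∈ e)
        omega
      · intro P hP Q hQ hPQ
        simp only [Finset.coe_filter, Finset.mem_filter, Set.mem_ofPred_eq] at hP hQ hPQ
        rw [← Finset.filter_union_filter_not_eq (fun e => u ∈ e) P,
          ← Finset.filter_union_filter_not_eq (fun e => u ∈ e) Q, hP.2, hQ.2, hPQ]
    · refine (Finset.card_eq_zero.2 (Finset.filter_eq_empty_iff.2 ?_)).le
      intro P hP hPS
      have := Finset.card_filter_le P fun e => u ∈ e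
      have := (Finset.mem_filter.1 hP).2.1
      rw [hPS] at *
      omega

theorem eachComponentMeets_singleton {V : Type*} {P : Finset (Sym2 V)} {v : V}
    (hv : ∃ e ∈ P, v ∈ e) (hP : (edgeGraphS P).Preconnected) : EachComponentMeets {v} P := by
  obtain ⟨e, he, hve⟩ := hv
  rintro T hT ⟨f, hf⟩
  by_cases heT : e ∈ T
  · exact ⟨e, heT, v, hve, Or.inl (Finset.mem_singleton_self v)⟩
  obtain ⟨p⟩ := hP ⟨f, hT hf⟩ ⟨e, he⟩
  obtain ⟨a, -, ha, ha'⟩ := p.exists_boundary_dart {g | g.1 ∈ T} hf heT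
  obtain ⟨-, ⟨x, hx, hx'⟩ | ⟨x, hx', hx⟩⟩ := (SimpleGraph.fromRel_adj _ _ _).1 a.adj <;>
  exact ⟨a.fst.1, ha, x, hx, Or.inr ⟨a.snd.1, a.snd.2, ha', hx'⟩⟩

theorem choose_mul_self_le_exp_mul_pow (b d : ℕ) :
    ((b * d).choose b : ℝ) ≤ (Real.exp 1 * d) ^ b := by
  calc ((b * d).choose b : ℝ) ≤ ((b * d : ℕ) : ℝ) ^ b / b.factorial := Nat.choose_le_pow_div _ _
    _ = (b : ℝ) ^ b / b.factorial * (d : ℝ) ^ b := by push_cast; ring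
    _ ≤ Real.exp b * (d : ℝ) ^ b := by
        gcongr
        exact Real.pow_div_factorial_le_exp _ (Nat.cast_nonneg b) b
    _ = (Real.exp 1 * d) ^ b := by rw [mul_pow, ← Real.exp_nat_mul, mul_one]

theorem stmt8 {V : Type*} [Fintype V] [DecidableEq V] (G : SimpleGraph V)
    [DecidableRel G.Adj] (v : V) (b : ℕ) (hb : 1 ≤ b) :
    ((G.edgeFinset.powerset.filter fun P =>
        (∃ e ∈ P, v ∈ e) ∧ P.card = b ∧
          Nat.card (edgeGraphS P).ConnectedComponent = 1).card : ℝ)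
      ≤ (Real.exp 1 * G.maxDegree) ^ b := by
  have hdeg : ∀ u, (G.edgeFinset.filter fun e => u ∈ e).card ≤ G.maxDegree := fun u => by
    refine le_trans (le_of_eq ?_) (G.degree_le_maxDegree u)
    rw [← G.card_incidenceFinset_eq_degree u, G.incidenceFinset_eq_filter u]
  refine le_trans (Nat.cast_le.2 ((Finset.card_le_card fun P hP => ?_).trans
    (card_eachComponentMeets_le G.maxDegree b {v} G.edgeFinset b
      (fun u => by convert hdeg u)
      (by rw [Finset.card_singleton, add_comm])))) (choose_mul_self_le_exp_mul_pow b _)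
  simp only [Finset.mem_filter] at hP ⊢
  obtain ⟨hPG, hv, hPb, hcard⟩ := hP
  have := (Nat.card_eq_one_iff_unique.1 hcard).1
  exact ⟨hPG, hPb, eachComponentMeets_singleton hv fun x y =>
    SimpleGraph.ConnectedComponent.exact (Subsingleton.elim _ _)⟩

end
end

section
/- Let r ≥ 2 and k ≥ 1 be integers and let n be sufficiently large. Fix a cyclic ordering σ ∈ Q_n and a subhypergraph P of H_σ with b ≥ 1 edges and s connected components. Then the number of cyclic orderings τ ∈ Q_n such that every edge of P is an edge of H_τ is at most (n - |V(P)| + s - 1)! · (2k+2r-4)^{|V(P)|-s} / 2, where V(P) is the set of vertices covered by the edges of P. -/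
open scoped Classical
open Finset

noncomputable section

/-- The number of elements of `B` whose position is less than `a`. -/
def countBelow {V : Type*} (p : V → ℕ) (B : Finset V) (a : ℕ) : ℕ :=
  (B.filter fun y => p y < a).card

/-- The strict order induced on `B` by the position function `p`, as a set of pairs. -/
def orderOn {V : Type*} (p : V → ℕ) (B : Finset V) : Finset (V × V) :=
  (B ×ˢ B).filter fun q => p q.1 < p q.2

lemma mem_orderOn {V : Type*} {p : V → ℕ} {B : Finset V} {x y : V} :
    (x, y) ∈ orderOn p B ↔ (x ∈ B ∧ y ∈ B) ∧ p x < p y := by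
  simp [orderOn]

lemma countBelow_mono {V : Type*} (p : V → ℕ) (B : Finset V) {a b : ℕ} (h : a ≤ b) :
    countBelow p B a ≤ countBelow p B b :=
  card_le_card fun x hx => by
    simp only [mem_filter] at hx ⊢
    exact ⟨hx.1, by omega⟩

lemma countBelow_zero {V : Type*} (p : V → ℕ) (B : Finset V) : countBelow p B 0 = 0 := by
  simp [countBelow]

lemma countBelow_eq_card {V : Type*} {p : V → ℕ} {n : ℕ} (hp : ∀ v, p v < n) (B : Finset V) :
    countBelow p B n = B.card := by
  simp [countBelow, hp]

lemma countBelow_succ_le {V : Type*} {p : V → ℕ} (hp : Function.Injective p) (B : Finset V)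
    (a : ℕ) : countBelow p B (a + 1) ≤ countBelow p B a + 1 := by
  have h : (B.filter fun y => p y < a + 1) =
      (B.filter fun y => p y < a) ∪ B.filter fun y => p y = a := by
    ext y
    simp only [mem_filter, mem_union, ← and_or_left]
    exact and_congr_right fun _ => by omega
  unfold countBelow
  rw [h]
  refine (card_union_le _ _).trans (Nat.add_le_add_left ?_ _)
  refine card_le_one.2 fun x hx y hy => hp ?_
  simp only [mem_filter] at hx hy
  omega

lemma countBelow_add_le {V : Type*} {p : V → ℕ} (hp : Function.Injective p) (B : Finset V)
    (a d : ℕ) : countBelow p B (a + d) ≤ countBelow p B a + d := by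
  induction d with
  | zero => simp
  | succ d ih =>
    have := countBelow_succ_le hp B (a + d)
    rw [← add_assoc]
    omega

lemma countBelow_lt_succ {V : Type*} {p : V → ℕ} {B : Finset V} {u : V} (hu : u ∈ B) :
    countBelow p B (p u) < countBelow p B (p u + 1) := by
  refine card_lt_card ⟨fun x hx => ?_, fun h => ?_⟩
  · simp only [mem_filter] at hx ⊢
    exact ⟨hx.1, by omega⟩
  · have := h (show u ∈ _ by simp [hu])
    simp at this

lemma countBelow_succ_of_notMem {V : Type*} {p : V → ℕ} (hp : Function.Injective p)
    {B : Finset V} {v : V} (hv : v ∉ B) :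
    countBelow p B (p v + 1) = countBelow p B (p v) := by
  unfold countBelow
  congr 1
  refine filter_congr fun y hy => ?_
  have : p y ≠ p v := fun h => hv (hp h ▸ hy)
  omega

lemma lt_iff_countBelow_lt {V : Type*} {p : V → ℕ} {B : Finset V} {y : V} (hy : y ∈ B) (a : ℕ) :
    p y < a ↔ countBelow p B (p y) < countBelow p B a := by
  constructor
  · intro h
    exact (countBelow_lt_succ hy).trans_le (countBelow_mono p B h)
  · intro h
    by_contra! h'
    exact absurd (countBelow_mono p B h') (by omega)

lemma countBelow_univ {V : Type*} [Fintype V] {p : V → ℕ} (hp : Function.Injective p)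
    (hlt : ∀ v, p v < Fintype.card V) {a : ℕ} (ha : a ≤ Fintype.card V) :
    countBelow p univ a = a := by
  have h1 := countBelow_add_le hp univ 0 a
  have h2 := countBelow_add_le hp univ a (Fintype.card V - a)
  rw [Nat.add_sub_cancel' ha, countBelow_eq_card hlt, card_univ] at h2
  rw [countBelow_zero, zero_add] at h1
  omega

lemma countBelow_eq_of_orderOn_eq {V : Type*} {p q : V → ℕ} {B : Finset V}
    (h : orderOn p B = orderOn q B) {u : V} (hu : u ∈ B) :
    countBelow p B (p u) = countBelow q B (q u) := by
  unfold countBelow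
  congr 1
  refine filter_congr fun y hy => ?_
  have := mem_orderOn (p := p) (B := B) (x := y) (y := u)
  rw [h, mem_orderOn] at this
  simpa [hu, hy] using this.symm

lemma orderOn_insert_eq {V : Type*} {p q : V → ℕ} (hp : Function.Injective p)
    (hq : Function.Injective q) {B : Finset V} (h : orderOn p B = orderOn q B) {v : V}
    (hv : v ∉ B) (hc : countBelow p B (p v) = countBelow q B (q v)) :
    orderOn p (insert v B) = orderOn q (insert v B) := by
  have key : ∀ y ∈ B, (p y < p v ↔ q y < q v) := fun y hy => by
    rw [lt_iff_countBelow_lt hy, lt_iff_countBelow_lt hy, hc, countBelow_eq_of_orderOn_eq h hy]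
  have key' : ∀ y ∈ B, (p v < p y ↔ q v < q y) := fun y hy => by
    have h1 : p y ≠ p v := fun h => hv (hp h ▸ hy)
    have h2 : q y ≠ q v := fun h => hv (hq h ▸ hy)
    have := key y hy
    omega
  ext ⟨x, y⟩
  rw [mem_orderOn, mem_orderOn]
  refine and_congr_right fun hxy => ?_
  simp only [mem_insert] at hxy
  rcases hxy with ⟨rfl | hx, rfl | hy⟩
  · simp
  · exact key' y hy
  · exact key x hx
  · have := mem_orderOn (p := p) (B := B) (x := x) (y := y)
    rw [h, mem_orderOn] at this
    simpa [hx, hy] using this.symm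

lemma card_image_le_of_factor {ι α β : Type*} [DecidableEq α] [DecidableEq β] {T : Finset ι} (f : ι → α) (g : ι → β)
    (h : ∀ s ∈ T, ∀ t ∈ T, g s = g t → f s = f t) :
    (T.image f).card ≤ (T.image g).card := by
  rcases isEmpty_or_nonempty ι with _ | _
  · simp [eq_empty_of_isEmpty T]
  choose! c hc using fun (b : β) (hb : b ∈ T.image g) => mem_image.1 hb
  refine (card_le_card fun a ha => ?_).trans (card_image_le (s := T.image g) (f := fun b => f (c b)))
  obtain ⟨t, ht, rfl⟩ := mem_image.1 ha
  have hg := mem_image_of_mem g ht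
  exact mem_image.2 ⟨g t, hg, h _ (hc _ hg).1 _ ht (hc _ hg).2⟩

/-- If the rank of a new element is determined, given the order on `B`, by a code with values
in `D`, then inserting it multiplies the number of induced orders by at most `#D`. -/
lemma card_image_orderOn_insert_le {ι V : Type*} {T : Finset ι} {pos : ι → V → ℕ}
    (hinj : ∀ t ∈ T, Function.Injective (pos t)) {B : Finset V} {v : V} (hv : v ∉ B)
    {γ : Type*} (D : Finset γ) (R : ι → γ → Prop) (hR : ∀ t ∈ T, ∃ d ∈ D, R t d)
    (hdet : ∀ s ∈ T, ∀ t ∈ T, orderOn (pos s) B = orderOn (pos t) B → ∀ d ∈ D, R s d → R t d →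
      countBelow (pos s) B (pos s v) = countBelow (pos t) B (pos t v)) :
    (T.image fun t => orderOn (pos t) (insert v B)).card ≤
      (T.image fun t => orderOn (pos t) B).card * D.card := by
  by_cases hT : T.Nonempty
  swap
  · rw [not_nonempty_iff_eq_empty.1 hT]
    simp
  obtain ⟨t₀, ht₀⟩ := hT
  have : Nonempty γ := ⟨(hR t₀ ht₀).choose⟩
  choose! d hd using hR
  refine (card_image_le_of_factor _ (fun t => (orderOn (pos t) B, d t)) ?_).trans ?_
  · intro s hs t ht hst
    obtain ⟨h1, h2⟩ := Prod.mk.inj hst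
    exact orderOn_insert_eq (hinj s hs) (hinj t ht) h1 hv
      (hdet s hs t ht h1 (d s) (hd s hs).1 (hd s hs).2 (h2 ▸ (hd t ht).2))
  · rw [← card_product]
    refine card_le_card fun x hx => ?_
    obtain ⟨t, ht, rfl⟩ := mem_image.1 hx
    exact mem_product.2 ⟨mem_image_of_mem _ ht, (hd t ht).1⟩

lemma countBelow_pos {V : Type*} {p : V → ℕ} (hp : Function.Injective p) {z : V} (hz : p z = 0)
    {B : Finset V} (hzB : z ∈ B) {v : V} (hv : v ∉ B) : 0 < countBelow p B (p v) := by
  have h : p z < p v := by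
    have : p z ≠ p v := fun h => hv (hp h ▸ hzB)
    omega
  exact (Nat.zero_le _).trans_lt ((lt_iff_countBelow_lt hzB _).1 h)

lemma card_image_orderOn_le_factorial {ι V : Type*} {T : Finset ι} {pos : ι → V → ℕ}
    (hinj : ∀ t ∈ T, Function.Injective (pos t)) {z : V} (hz : ∀ t ∈ T, pos t z = 0)
    {B : Finset V} (hB : z ∉ B) :
    (T.image fun t => orderOn (pos t) (insert z B)).card ≤ B.card.factorial := by
  induction B using Finset.induction_on with
  | empty =>
    refine card_le_one.2 fun x hx y hy => ?_
    obtain ⟨s, -, rfl⟩ := mem_image.1 hx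
    obtain ⟨t, -, rfl⟩ := mem_image.1 hy
    ext ⟨a, b⟩
    simp only [mem_orderOn, insert_empty_eq, mem_singleton]
    constructor <;> rintro ⟨⟨rfl, rfl⟩, h⟩ <;> omega
  | insert w B hw ih =>
    rw [mem_insert, not_or] at hB
    have hwz : w ∉ insert z B := by
      rw [mem_insert, not_or]
      exact ⟨fun h => hB.1 h.symm, hw⟩
    rw [Finset.insert_comm, card_insert_of_notMem hw, Nat.factorial_succ, mul_comm]
    have := card_image_orderOn_insert_le hinj hwz (Finset.Icc 1 (B.card + 1))
      (fun t d => countBelow (pos t) (insert z B) (pos t w) = d)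
      (fun t ht => ⟨_, mem_Icc.2 ⟨countBelow_pos (hinj t ht) (hz t ht) (mem_insert_self _ _) hwz,
        ?_⟩, rfl⟩)
      (fun s _ t _ _ d _ h1 h2 => h1.trans h2.symm)
    · rw [Nat.card_Icc, Nat.add_sub_cancel] at this
      exact this.trans (Nat.mul_le_mul_right _ (ih hB.2))
    · rw [← card_insert_of_notMem hB.2]
      exact card_filter_le _ _

/-- If `v ∉ B` is at cyclic distance at most `m` from `u ∈ B`, its rank in `B` is within a set
of `2 * m` residues relative to the rank of `u`. -/
lemma exists_rank_offset {V : Type*} {p : V → ℕ} (hp : Function.Injective p) {n m : ℕ}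
    (hlt : ∀ v, p v < n) (hmn : m < n) {B : Finset V} {u v : V} (hu : u ∈ B) (hv : v ∉ B)
    {δ : ℤ} (hδ : |δ| ≤ m) (hdvd : (n : ℤ) ∣ p v - p u - δ) :
    ∃ d ∈ Finset.Ioc (-m : ℤ) m,
      (B.card : ℤ) ∣ countBelow p B (p v) - countBelow p B (p u) - d := by
  have hne : p u ≠ p v := fun h => hv (hp h ▸ hu)
  have hu' := hlt u
  have hv' := hlt v
  rw [abs_le] at hδ
  obtain ⟨t, ht⟩ := hdvd
  have h1 := countBelow_lt_succ (p := p) hu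
  have h2 := countBelow_succ_of_notMem hp hv
  have hn := countBelow_eq_card hlt B
  have h0 := countBelow_zero p B
  have inc : ∀ a b, a ≤ b → countBelow p B a ≤ countBelow p B b ∧
      countBelow p B b ≤ countBelow p B a + (b - a) := fun a b hab =>
    ⟨countBelow_mono p B hab, by
      have := countBelow_add_le hp B a (b - a)
      rwa [Nat.add_sub_cancel' hab] at this⟩
  have i0 := inc (p u) (p u + 1) (Nat.le_succ _)
  have ht1 : t < 2 := by nlinarith
  have ht2 : -2 < t := by nlinarith
  have i1 := inc 0 (p v) (Nat.zero_le _)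
  have i2 := inc 0 (p u) (Nat.zero_le _)
  have i3 := inc (p v + 1) n hv'
  have i4 := inc (p u + 1) n hu'
  have hcases : t = -1 ∨ t = 0 ∨ t = 1 := by omega
  rcases Nat.lt_or_gt_of_ne hne with huv | huv
  · have i5 := inc (p u + 1) (p v) huv
    have i6 := inc (p u) (p v) huv.le
    rcases hcases with rfl | rfl | rfl
    · omega
    · exact ⟨countBelow p B (p v) - countBelow p B (p u), by rw [mem_Ioc]; omega, by simp⟩
    · exact ⟨countBelow p B (p v) - countBelow p B (p u) - B.card, by rw [mem_Ioc]; omega,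
        by simp⟩
  · have i5 := inc (p v + 1) (p u) huv
    have i6 := inc (p v) (p u) huv.le
    rcases hcases with rfl | rfl | rfl
    · exact ⟨countBelow p B (p v) - countBelow p B (p u) + B.card, by rw [mem_Ioc]; omega,
        ⟨-1, by ring⟩⟩
    · exact ⟨countBelow p B (p v) - countBelow p B (p u), by rw [mem_Ioc]; omega, by simp⟩
    · omega

lemma card_image_orderOn_insert_le_of_close {ι V : Type*} {T : Finset ι} {pos : ι → V → ℕ}
    (hinj : ∀ t ∈ T, Function.Injective (pos t)) {n m : ℕ} (hlt : ∀ t ∈ T, ∀ v, pos t v < n)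
    (hmn : m < n) {z : V} (hz : ∀ t ∈ T, pos t z = 0) {B : Finset V} (hzB : z ∈ B) {u v : V}
    (hu : u ∈ B) (hv : v ∉ B)
    (hclose : ∀ t ∈ T, ∃ δ : ℤ, |δ| ≤ m ∧ (n : ℤ) ∣ pos t v - pos t u - δ) :
    (T.image fun t => orderOn (pos t) (insert v B)).card ≤
      (T.image fun t => orderOn (pos t) B).card * (2 * m) := by
  have hcard : (Finset.Ioc (-m : ℤ) m).card = 2 * m := by
    rw [Int.card_Ioc]
    omega
  rw [← hcard]
  refine card_image_orderOn_insert_le hinj hv _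
    (fun t d => (B.card : ℤ) ∣ countBelow (pos t) B (pos t v) - countBelow (pos t) B (pos t u) - d)
    (fun t ht => ?_) (fun s hs t ht hst d _ h1 h2 => ?_)
  · obtain ⟨δ, hδ, hdvd⟩ := hclose t ht
    exact exists_rank_offset (hinj t ht) (hlt t ht) hmn hu hv hδ hdvd
  · rw [countBelow_eq_of_orderOn_eq hst hu] at h1
    have p1 := countBelow_pos (hinj s hs) (hz s hs) hzB hv
    have p2 := countBelow_pos (hinj t ht) (hz t ht) hzB hv
    have l1 : countBelow (pos s) B (pos s v) ≤ B.card := card_filter_le _ _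
    have l2 : countBelow (pos t) B (pos t v) ≤ B.card := card_filter_le _ _
    obtain ⟨c, hc⟩ := dvd_sub h1 h2
    have c1 : c < 1 := by nlinarith
    have c2 : -1 < c := by nlinarith
    obtain rfl : c = 0 := by omega
    rw [mul_zero] at hc
    omega

/-- Position functions on `V` in which one can grow `B` to all of `V` by repeatedly adding an
element that is always cyclically `m`-close to a present one. -/
lemma card_le_factorial_mul_pow {ι V : Type*} [Fintype V] {T : Finset ι} {pos : ι → V → ℕ}
    (hpos : ∀ s ∈ T, ∀ t ∈ T, pos s = pos t → s = t)
    (hinj : ∀ t ∈ T, Function.Injective (pos t)) {m : ℕ}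
    (hlt : ∀ t ∈ T, ∀ v, pos t v < Fintype.card V) (hmn : m < Fintype.card V) {z : V}
    (hz : ∀ t ∈ T, pos t z = 0) {B : Finset V} (hzB : z ∈ B)
    (hgrow : ∀ A : Finset V, B ⊆ A → A ≠ univ → ∃ u ∈ A, ∃ v ∉ A, ∀ t ∈ T,
      ∃ δ : ℤ, |δ| ≤ m ∧ (Fintype.card V : ℤ) ∣ pos t v - pos t u - δ) :
    T.card ≤ (B.card - 1).factorial * (2 * m) ^ (Fintype.card V - B.card) := by
  have step : ∀ j, j ≤ Fintype.card V - B.card → ∃ A : Finset V, B ⊆ A ∧ A.card = B.card + j ∧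
      (T.image fun t => orderOn (pos t) A).card ≤ (B.card - 1).factorial * (2 * m) ^ j := by
    intro j
    induction j with
    | zero =>
      refine fun _ => ⟨B, Subset.rfl, rfl, ?_⟩
      have := card_image_orderOn_le_factorial hinj hz (notMem_erase z B)
      rwa [insert_erase hzB, card_erase_of_mem hzB, ← mul_one (Nat.factorial _),
        ← pow_zero (2 * m)] at this
    | succ j ih =>
      intro hj
      obtain ⟨A, hBA, hA, hle⟩ := ih (by omega)
      have hne : A ≠ univ := by
        rintro rfl
        rw [card_univ] at hA
        omega
      obtain ⟨u, hu, v, hv, hclose⟩ := hgrow A hBA hne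
      refine ⟨insert v A, hBA.trans (subset_insert _ _), by rw [card_insert_of_notMem hv]; omega, ?_⟩
      refine (card_image_orderOn_insert_le_of_close hinj hlt hmn hz (hBA hzB) hu hv hclose).trans ?_
      rw [pow_succ, ← mul_assoc (Nat.factorial _)]
      exact Nat.mul_le_mul_right _ hle
  obtain ⟨A, -, hA, hle⟩ := step _ le_rfl
  obtain rfl : A = univ := by
    rw [← card_eq_iff_eq_univ, hA]
    have := card_le_univ B
    omega
  rwa [card_image_of_injOn] at hle
  intro s hs t ht hst
  refine hpos s hs t ht (funext fun v => ?_)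
  have := countBelow_eq_of_orderOn_eq hst (mem_univ v)
  rwa [countBelow_univ (hinj s hs) (hlt s hs) (hlt s hs v).le,
    countBelow_univ (hinj t ht) (hlt t ht) (hlt t ht v).le] at this

/-- The cyclic orderings rooted at vertex `0` in which any two vertices of an edge of `P` are at
cyclic distance at most `m`. -/
def closeOrderings (n m : ℕ) [NeZero n] (P : Finset (Finset (Fin n))) :
    Finset (ZMod n → Fin n) :=
  Finset.univ.filter fun τ => Function.Bijective τ ∧ τ 0 = 0 ∧
    ∀ e ∈ P, ∀ u ∈ e, ∀ v ∈ e, ∃ i : ZMod n, ∃ δ : ℤ, |δ| ≤ m ∧ τ i = u ∧ τ (i + δ) = v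

lemma two_mul_card_le_closeOrderings (r k n : ℕ) [NeZero n] (hr : 2 ≤ r)
    (P : Finset (Finset (Fin n))) :
    2 * Nat.card {τ : ZMod n → Fin n // IsCycRep n τ ∧ P ⊆ hamPowEdges r k n τ} ≤
      (closeOrderings n (k + r - 2) P).card := by
  set A : Finset (ZMod n → Fin n) :=
    Finset.univ.filter fun τ => IsCycRep n τ ∧ P ⊆ hamPowEdges r k n τ with hA
  have hcard : Nat.card {τ : ZMod n → Fin n // IsCycRep n τ ∧ P ⊆ hamPowEdges r k n τ} =
      A.card := by
    rw [Nat.card_eq_fintype_card, Fintype.card_subtype]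
  have hsub : A ⊆ closeOrderings n (k + r - 2) P := by
    intro τ hτ
    simp only [hA, mem_filter, mem_univ, true_and] at hτ
    obtain ⟨⟨hbij, h0, -⟩, hP⟩ := hτ
    simp only [closeOrderings, mem_filter, mem_univ, true_and]
    refine ⟨hbij, Fin.ext h0, fun e he u hu v hv => ?_⟩
    have he' := hP he
    simp only [hamPowEdges, mem_filter, mem_univ, true_and] at he'
    obtain ⟨-, i, hi⟩ := he'
    obtain ⟨a, ha, rfl⟩ := mem_image.1 (hi hu)
    obtain ⟨b, hb, rfl⟩ := mem_image.1 (hi hv)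
    simp only [Finset.bind_def, Finset.pure_def, mem_sup, mem_singleton, mem_range] at ha hb
    obtain ⟨a, ha, rfl⟩ := ha
    obtain ⟨b, hb, rfl⟩ := hb
    refine ⟨i + a, (b : ℤ) - a, ?_, rfl, ?_⟩
    · rw [abs_le]
      omega
    · congr 1
      push_cast
      ring
  set ρ : (ZMod n → Fin n) → ZMod n → Fin n := fun τ i => τ (-i) with hρ
  have hρinj : Function.Injective ρ := fun τ τ' h => funext fun i => by
    simpa [hρ] using congrFun h (-i)
  have hsubρ : A.image ρ ⊆ closeOrderings n (k + r - 2) P := by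
    intro x hx
    obtain ⟨τ, hτ, rfl⟩ := mem_image.1 hx
    have hτ' := hsub hτ
    simp only [closeOrderings, mem_filter, mem_univ, true_and] at hτ' ⊢
    obtain ⟨hbij, h0, hcl⟩ := hτ'
    refine ⟨hbij.comp neg_involutive.bijective, by simp [hρ, h0], fun e he u hu v hv => ?_⟩
    obtain ⟨i, δ, hδ, h1, h2⟩ := hcl e he u hu v hv
    refine ⟨-i, -δ, by rwa [abs_neg], by simpa [hρ] using h1, ?_⟩
    rw [← h2]
    simp only [hρ]
    congr 1
    push_cast
    ring
  have hdisj : Disjoint A (A.image ρ) := by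
    rw [disjoint_left]
    intro x hx hx'
    obtain ⟨τ, hτ, rfl⟩ := mem_image.1 hx'
    simp only [hA, mem_filter, mem_univ, true_and] at hτ hx
    have h1 := hτ.1.2.2
    have h2 := hx.1.2.2
    simp only [hρ, neg_neg] at h2
    omega
  rw [hcard, two_mul]
  calc A.card + A.card = (A ∪ A.image ρ).card := by
        rw [card_union_of_disjoint hdisj, card_image_of_injective _ hρinj]
    _ ≤ _ := card_le_card (union_subset hsub hsubρ)

/-- A set of representatives, containing `z`, for the connected components of the hypergraph
`P` with all uncovered vertices counted as components. -/
lemma exists_roots {n : ℕ} (P : Finset (Finset (Fin n))) (hne : ∀ e ∈ P, e.Nonempty)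
    (z : Fin n) : numComp P ≤ (vertsOf P).card ∧ ∃ B : Finset (Fin n), z ∈ B ∧
      B.card = n - (vertsOf P).card + numComp P ∧
      ∀ A : Finset (Fin n), B ⊆ A → A ≠ univ → ∃ u ∈ A, ∃ v ∉ A, ∃ e ∈ P, u ∈ e ∧ v ∈ e := by
  have hx : ∀ c : (edgeGraph P).ConnectedComponent, ∃ x : Fin n,
      (∃ e : {e // e ∈ P}, (edgeGraph P).connectedComponentMk e = c ∧ x ∈ e.1) ∧
      ((∃ e : {e // e ∈ P}, (edgeGraph P).connectedComponentMk e = c ∧ z ∈ e.1) → x = z) := by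
    intro c
    by_cases h : ∃ e : {e // e ∈ P}, (edgeGraph P).connectedComponentMk e = c ∧ z ∈ e.1
    · exact ⟨z, h, fun _ => rfl⟩
    · obtain ⟨e, he⟩ := c.exists_rep
      obtain ⟨x, hx⟩ := hne e.1 e.2
      exact ⟨x, ⟨e, he, hx⟩, fun h' => absurd h' h⟩
  choose x hxe hxz using hx
  have hconn : ∀ e f : {e // e ∈ P}, ∀ y, y ∈ e.1 → y ∈ f.1 →
      (edgeGraph P).connectedComponentMk e = (edgeGraph P).connectedComponentMk f := by
    intro e f y he hf
    by_cases hef : e = f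
    · rw [hef]
    · refine SimpleGraph.ConnectedComponent.sound (SimpleGraph.Adj.reachable ?_)
      exact (SimpleGraph.fromRel_adj _ _ _).2 ⟨hef, Or.inl ⟨y, mem_inter.2 ⟨he, hf⟩⟩⟩
  have hxinj : Function.Injective x := by
    intro c d hcd
    obtain ⟨e, rfl, he⟩ := hxe c
    obtain ⟨f, rfl, hf⟩ := hxe d
    exact hconn e f _ he (hcd ▸ hf)
  have hxV : ∀ c, x c ∈ vertsOf P := fun c => by
    obtain ⟨e, -, he⟩ := hxe c
    exact mem_biUnion.2 ⟨e.1, e.2, he⟩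
  have : Fintype (edgeGraph P).ConnectedComponent := Fintype.ofFinite _
  have hcard : (univ.image x).card = numComp P := by
    rw [card_image_of_injective _ hxinj, card_univ, numComp, Nat.card_eq_fintype_card]
  refine ⟨?_, (vertsOf P)ᶜ ∪ univ.image x, ?_, ?_, ?_⟩
  · rw [← hcard]
    refine card_le_card fun y hy => ?_
    obtain ⟨c, -, rfl⟩ := mem_image.1 hy
    exact hxV c
  · by_cases h : z ∈ vertsOf P
    · obtain ⟨e, he, hze⟩ := mem_biUnion.1 h
      exact mem_union_right _ (mem_image.2 ⟨_, mem_univ _, hxz _ ⟨⟨e, he⟩, rfl, hze⟩⟩)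
    · exact mem_union_left _ (mem_compl.2 h)
  · rw [card_union_of_disjoint, card_compl, hcard, Fintype.card_fin]
    rw [disjoint_right]
    intro y hy
    obtain ⟨c, -, rfl⟩ := mem_image.1 hy
    simpa using hxV c
  · intro A hBA hA
    by_contra! hno
    have hclosed : ∀ e ∈ P, ∀ u ∈ e, u ∈ A → e ⊆ A := fun e he u hu huA v hv => by
      by_contra hvA
      exact hno u huA v hvA e he hu hv
    refine hA (eq_univ_iff_forall.2 fun v => ?_)
    by_cases hv : v ∈ vertsOf P
    swap
    · exact hBA (mem_union_left _ (mem_compl.2 hv))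
    obtain ⟨e, he, hve⟩ := mem_biUnion.1 hv
    obtain ⟨f, hf, hxf⟩ := hxe ((edgeGraph P).connectedComponentMk ⟨e, he⟩)
    have hxA : x ((edgeGraph P).connectedComponentMk ⟨e, he⟩) ∈ A :=
      hBA (mem_union_right _ (mem_image_of_mem _ (mem_univ _)))
    have hfA : f.1 ⊆ A := hclosed f.1 f.2 _ hxf hxA
    obtain ⟨w⟩ := SimpleGraph.ConnectedComponent.exact hf
    have hwalk : ∀ a b : {e // e ∈ P}, (edgeGraph P).Walk a b → a.1 ⊆ A → b.1 ⊆ A := by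
      intro a b w
      induction w with
      | nil => exact id
      | @cons a c _ hadj _ ih =>
        intro ha
        refine ih ?_
        have hac := ((SimpleGraph.fromRel_adj _ _ _).1 hadj).2
        rw [inter_comm c.1 a.1, or_self] at hac
        obtain ⟨y, hy⟩ := hac
        rw [mem_inter] at hy
        exact hclosed c.1 c.2 y hy.2 (ha hy.1)
    exact hwalk _ _ w hfA hve

lemma card_closeOrderings_le {n m : ℕ} [NeZero n] (hmn : m < n) (P : Finset (Finset (Fin n)))
    (hne : ∀ e ∈ P, e.Nonempty) :
    (closeOrderings n m P).card ≤ (n - (vertsOf P).card + numComp P - 1).factorial *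
      (2 * m) ^ ((vertsOf P).card - numComp P) := by
  obtain ⟨hle, B, hzB, hB, hgrow⟩ := exists_roots P hne 0
  have hV : (vertsOf P).card ≤ n := by simpa using card_le_univ (vertsOf P)
  have hmem : ∀ τ ∈ closeOrderings n m P, Function.Bijective τ ∧ τ 0 = 0 ∧
      ∀ e ∈ P, ∀ u ∈ e, ∀ v ∈ e, ∃ i : ZMod n, ∃ δ : ℤ, |δ| ≤ m ∧ τ i = u ∧ τ (i + δ) = v :=
    fun τ hτ => by simpa only [closeOrderings, mem_filter, mem_univ, true_and] using hτ
  have hinv : ∀ τ ∈ closeOrderings n m P, ∀ i, Function.invFun τ (τ i) = i := fun τ hτ i =>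
    Function.leftInverse_invFun (hmem τ hτ).1.1 i
  have hinv' : ∀ τ ∈ closeOrderings n m P, ∀ v, τ (Function.invFun τ v) = v := fun τ hτ v =>
    Function.rightInverse_invFun (hmem τ hτ).1.2 v
  have key := card_le_factorial_mul_pow (T := closeOrderings n m P)
    (pos := fun τ v => (Function.invFun τ v).val) (m := m) (z := (0 : Fin n)) (B := B)
    ?_ ?_ ?_ ?_ ?_ hzB ?_
  · rwa [Fintype.card_fin, hB, show n - (n - (vertsOf P).card + numComp P) =
      (vertsOf P).card - numComp P by omega] at key
  · intro σ hσ τ hτ h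
    funext i
    have := ZMod.val_injective n (congrFun h (σ i))
    rw [hinv σ hσ] at this
    exact (hinv' τ hτ (σ i)).symm.trans (congrArg τ this.symm)
  · intro τ hτ u v h
    rw [← hinv' τ hτ u, ZMod.val_injective n h, hinv' τ hτ]
  · intro τ _ v
    rw [Fintype.card_fin]
    exact ZMod.val_lt _
  · rwa [Fintype.card_fin]
  · intro τ hτ
    have := hinv τ hτ 0
    rw [(hmem τ hτ).2.1] at this
    simp [this]
  · intro A hBA hA
    obtain ⟨u, hu, v, hv, e, he, hue, hve⟩ := hgrow A hBA hA
    refine ⟨u, hu, v, hv, fun τ hτ => ?_⟩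
    obtain ⟨i, δ, hδ, rfl, rfl⟩ := (hmem τ hτ).2.2 e he u hue v hve
    refine ⟨δ, hδ, ?_⟩
    rw [Fintype.card_fin, hinv τ hτ, hinv τ hτ, ← ZMod.intCast_zmod_eq_zero_iff_dvd]
    simp

theorem stmt10 (r k : ℕ) (hr : 2 ≤ r) (hk : 1 ≤ k) :
    ∃ N : ℕ, ∀ n ≥ N, ∀ σ : ZMod n → Fin n, IsCycRep n σ →
      ∀ b s : ℕ, 1 ≤ b →
        ∀ P : Finset (Finset (Fin n)), P ⊆ hamPowEdges r k n σ → P.card = b →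
          numComp P = s →
          (Nat.card {τ : ZMod n → Fin n // IsCycRep n τ ∧ P ⊆ hamPowEdges r k n τ} : ℝ)
            ≤ ((n - (vertsOf P).card + s - 1).factorial : ℝ) *
                (2 * (k : ℝ) + 2 * r - 4) ^ ((vertsOf P).card - s) / 2 := by
  refine ⟨k + r, fun n hn σ _ b s _ P hP _ hs => ?_⟩
  have : NeZero n := ⟨by omega⟩
  have hne : ∀ e ∈ P, e.Nonempty := fun e he => by
    have := hP he
    simp only [hamPowEdges, mem_filter, mem_univ, true_and] at this
    exact card_pos.1 (by omega)
  have h := (two_mul_card_le_closeOrderings r k n hr P).trans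
    (card_closeOrderings_le (show k + r - 2 < n by omega) P hne)
  rw [hs] at h
  have hm : ((k + r - 2 : ℕ) : ℝ) = (k : ℝ) + r - 2 := by
    rw [Nat.cast_sub (by omega)]
    push_cast
    ring
  have h' := (Nat.cast_le (α := ℝ)).2 h
  push_cast at h'
  rw [hm, show (2 : ℝ) * ((k : ℝ) + r - 2) = 2 * k + 2 * r - 4 by ring] at h'
  linarith

end
end
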